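/- arXiv:1206.1949 — 7 statements merged into one kernel-verified Lean document; each statement's English description precedes it below -/
import Mathlib

section
/- Let ι be a type of cardinality ℵ₁. Then the set of all nonempty compact max-plus convex subsets of ι → ℝ (product topology), endowed with the Vietoris topology, is homeomorphic to ι → ℝ. -/
/-- Max-plus convexity. -/
def MaxPlusConvex {ι : Type*} (A : Set (ι → ℝ)) : Prop :=
  ∀ a ∈ A, ∀ b ∈ A, ∀ t : ℝ, t ≤ 0 → (fun i => max (a i) (t + b i)) ∈ A

/-- The Vietoris topology on a family of subsets of a topological space `X`. -/
def vietoris {X : Type*} [TopologicalSpace X] (P : Set X → Prop) :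
    TopologicalSpace {A : Set X // P A} :=
  TopologicalSpace.generateFrom
    {S | ∃ U : Set X, IsOpen U ∧
      (S = {K : {A : Set X // P A} | (K : Set X) ⊆ U} ∨
        S = {K : {A : Set X // P A} | ((K : Set X) ∩ U).Nonempty})}

section

open Set Filter Topology TopologicalSpace

/-- In a metrizable space an open set is the positivity set of a continuous function
with values in `[0, 1]`. -/
theorem IsOpen.exists_continuous_pos_iff {X : Type*} [TopologicalSpace X]
    [TopologicalSpace.MetrizableSpace X] {O : Set X} (hO : IsOpen O) :
    ∃ D : X → ℝ, Continuous D ∧ (∀ x, 0 ≤ D x) ∧ (∀ x, D x ≤ 1) ∧ ∀ x, 0 < D x ↔ x ∈ O := by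
  let := TopologicalSpace.metrizableSpaceMetric X
  rcases (Oᶜ).eq_empty_or_nonempty with h | h
  · refine ⟨fun _ => 1, continuous_const, fun _ => zero_le_one, fun _ => le_rfl, fun x => ?_⟩
    simp [compl_empty_iff.1 h]
  · refine ⟨fun x => min 1 (Metric.infDist x Oᶜ), by fun_prop,
      fun x => le_min zero_le_one Metric.infDist_nonneg, fun x => min_le_left _ _, fun x => ?_⟩
    rw [lt_min_iff, ← hO.isClosed_compl.notMem_iff_infDist_pos h]
    simp

/-- A family of open intervals with open total space over a metrizable base is trivial. -/
theorem exists_interval_trivialization {P : Type*} [TopologicalSpace P]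
    [TopologicalSpace.MetrizableSpace P] {O : Set (P × ℝ)} (hO : IsOpen O)
    (hne : ∀ p, ∃ s, (p, s) ∈ O) (hc : ∀ p, OrdConnected {s | (p, s) ∈ O}) :
    ∃ F G : P × ℝ → ℝ, ContinuousOn F O ∧ Continuous G ∧ (∀ q : P × ℝ, (q.1, G q) ∈ O) ∧
      (∀ q : P × ℝ, F (q.1, G q) = q.2) ∧ ∀ q ∈ O, G (q.1, F q) = q.2 := by
  let := TopologicalSpace.metrizableSpaceMetric P
  obtain ⟨c, hcO⟩ : ∃ c : C(P, ℝ), ∀ p, c p ∈ {s | (p, s) ∈ O} := by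
    refine exists_continuous_forall_mem_convex_of_local_const (fun p => (hc p).convex) fun p => ?_
    obtain ⟨s, hs⟩ := hne p
    refine ⟨s, ?_⟩
    have : Continuous fun p : P => (p, s) := by fun_prop
    exact this.continuousAt.preimage_mem_nhds (hO.mem_nhds hs)
  obtain ⟨D, hDc, hD0, hD1, hDO⟩ := hO.exists_continuous_pos_iff
  let γ : P × ℝ → ℝ → P × ℝ := fun q τ => (q.1, c q.1 + τ * (q.2 - c q.1))
  let m : P × ℝ → ℝ := fun q => sInf ((fun τ => D (γ q τ)) '' Icc 0 1)
  have hm : Continuous m := by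
    refine isCompact_Icc.continuous_sInf ?_
    fun_prop
  have hbdd : ∀ q, BddBelow ((fun τ => D (γ q τ)) '' Icc 0 1) := fun q =>
    ⟨0, by rintro _ ⟨τ, -, rfl⟩; exact hD0 _⟩
  have hmem : ∀ q ∈ O, ∀ τ ∈ Icc (0 : ℝ) 1, γ q τ ∈ O := by
    intro q hq τ hτ
    have := (hc q.1).convex.add_smul_sub_mem (hcO q.1) (show q.2 ∈ {s | (q.1, s) ∈ O} from hq) hτ
    simpa [γ] using this
  have hmin : ∀ q, ∃ τ ∈ Icc (0 : ℝ) 1, m q = D (γ q τ) := fun q => by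
    obtain ⟨τ, hτ, h, -⟩ := isCompact_Icc.exists_sInf_image_eq_and_le (nonempty_Icc.2 zero_le_one)
      (show ContinuousOn (fun τ => D (γ q τ)) (Icc 0 1) from by fun_prop)
    exact ⟨τ, hτ, h⟩
  have hmpos : ∀ q ∈ O, 0 < m q := fun q hq => by
    obtain ⟨τ, hτ, h⟩ := hmin q
    rw [h, hDO]
    exact hmem q hq τ hτ
  have hmle : ∀ q, ∀ τ ∈ Icc (0 : ℝ) 1, m q ≤ D (γ q τ) := fun q τ hτ =>
    csInf_le (hbdd q) ⟨τ, hτ, rfl⟩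
  have hmD : ∀ q, m q ≤ D q := fun q => by
    simpa [γ] using hmle q 1 (by simp)
  -- `m` decreases away from the centre
  have hmono : ∀ p s τ, τ ∈ Icc (0 : ℝ) 1 → m (p, s) ≤ m (γ (p, s) τ) := by
    intro p s τ hτ
    obtain ⟨σ, hσ, h⟩ := hmin (γ (p, s) τ)
    rw [h]
    convert hmle (p, s) (σ * τ) ⟨mul_nonneg hσ.1 hτ.1, mul_le_one₀ hσ.2 hτ.1 hτ.2⟩ using 2
    simp only [γ]
    ring_nf
  let F : P × ℝ → ℝ := fun q => (q.2 - c q.1) / m q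
  have hF : ContinuousOn F O := by
    apply ContinuousOn.div (by fun_prop) hm.continuousOn
    exact fun q hq => (hmpos q hq).ne'
  have hFmono : ∀ p s s', (p, s) ∈ O → (p, s') ∈ O → s < s' → F (p, s) < F (p, s') := by
    intro p s s' hs hs' hlt
    have h1 := hmpos _ hs
    have h2 := hmpos _ hs'
    simp only [F]
    rcases le_or_gt (c p) s with h | h
    · have : m (p, s') ≤ m (p, s) := by
        have h3 : 0 < s' - c p := by linarith
        have := hmono p s' ((s - c p) / (s' - c p)) ⟨div_nonneg (by linarith) h3.le,
          (div_le_one h3).2 (by linarith)⟩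
        simpa [γ, div_mul_cancel₀ _ h3.ne'] using this
      calc (s - c p) / m (p, s) ≤ (s - c p) / m (p, s') := by gcongr
        _ < _ := by gcongr
    rcases le_or_gt s' (c p) with h' | h'
    · have : m (p, s) ≤ m (p, s') := by
        have h3 : s - c p < 0 := by linarith
        have := hmono p s ((s' - c p) / (s - c p)) ⟨div_nonneg_of_nonpos (by linarith) h3.le,
          (div_le_one_of_neg h3).2 (by linarith)⟩
        simpa [γ, div_mul_cancel₀ _ h3.ne] using this
      calc (s - c p) / m (p, s) < (s' - c p) / m (p, s) := by gcongr
        _ ≤ _ := by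
          rw [div_le_div_iff₀ h1 h2]
          nlinarith
    · calc (s - c p) / m (p, s) < 0 := div_neg_of_neg_of_pos (by linarith) h1
        _ < _ := div_pos (by linarith) h2
  -- surjectivity on the fibres
  have hup : ∀ p v, ∃ s, (p, s) ∈ O ∧ v ≤ F (p, s) := by
    intro p v
    by_contra! hcon
    have hv : 0 < v := by
      have := hcon (c p) (hcO p)
      simpa [F] using this
    have hub : ∀ s, (p, s) ∈ O → s ≤ c p + v := by
      intro s hs
      by_contra! hlt
      have h1 := hcon s hs
      simp only [F] at h1
      rw [div_lt_iff₀ (hmpos _ hs)] at h1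
      have := (hmD (p, s)).trans (hD1 _)
      nlinarith
    have hbd : BddAbove {s | (p, s) ∈ O} := ⟨_, fun s hs => hub s hs⟩
    have hop : IsOpen {s | (p, s) ∈ O} := hO.preimage (by fun_prop : Continuous fun s : ℝ => (p, s))
    set β := sSup {s | (p, s) ∈ O} with hβ
    have hβO : (p, β) ∉ O := by
      intro h
      obtain ⟨ε, hε, hsub⟩ := Metric.isOpen_iff.1 hop β h
      have : β + ε / 2 ∈ {s | (p, s) ∈ O} := hsub (by simp [abs_of_pos, hε])
      have := le_csSup hbd this
      linarith
    have hcβ : c p < β := lt_of_le_of_ne (le_csSup hbd (hcO p)) fun h => hβO (h ▸ hcO p)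
    have hcl : β ∈ closure {s | (p, s) ∈ O} := csSup_mem_closure ⟨_, hcO p⟩ hbd
    have hclosed : IsClosed {s : ℝ | s - c p ≤ v * D (p, s)} :=
      isClosed_le (by fun_prop) (by fun_prop)
    have : β ∈ {s : ℝ | s - c p ≤ v * D (p, s)} := by
      refine hclosed.closure_subset_iff.2 ?_ hcl
      intro s hs
      have h1 := hcon s hs
      simp only [F] at h1
      rw [div_lt_iff₀ (hmpos _ hs)] at h1
      have := hmD (p, s)
      simp only [mem_ofPred_eq]
      nlinarith
    simp only [mem_ofPred_eq] at this
    exact hβO ((hDO _).1 (by by_contra! h; nlinarith))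
  have hdown : ∀ p v, ∃ s, (p, s) ∈ O ∧ F (p, s) ≤ v := by
    intro p v
    by_contra! hcon
    have hv : v < 0 := by
      have := hcon (c p) (hcO p)
      simpa [F] using this
    have hub : ∀ s, (p, s) ∈ O → c p + v ≤ s := by
      intro s hs
      by_contra! hlt
      have h1 := hcon s hs
      simp only [F] at h1
      rw [lt_div_iff₀ (hmpos _ hs)] at h1
      have := (hmD (p, s)).trans (hD1 _)
      nlinarith
    have hbd : BddBelow {s | (p, s) ∈ O} := ⟨_, fun s hs => hub s hs⟩
    have hop : IsOpen {s | (p, s) ∈ O} := hO.preimage (by fun_prop : Continuous fun s : ℝ => (p, s))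
    set β := sInf {s | (p, s) ∈ O} with hβ
    have hβO : (p, β) ∉ O := by
      intro h
      obtain ⟨ε, hε, hsub⟩ := Metric.isOpen_iff.1 hop β h
      have : β - ε / 2 ∈ {s | (p, s) ∈ O} := hsub (by simp [abs_of_pos, hε])
      have := csInf_le hbd this
      linarith
    have hcβ : β < c p := lt_of_le_of_ne (csInf_le hbd (hcO p)) fun h => hβO (h ▸ hcO p)
    have hcl : β ∈ closure {s | (p, s) ∈ O} := csInf_mem_closure ⟨_, hcO p⟩ hbd
    have hclosed : IsClosed {s : ℝ | v * D (p, s) ≤ s - c p} :=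
      isClosed_le (by fun_prop) (by fun_prop)
    have : β ∈ {s : ℝ | v * D (p, s) ≤ s - c p} := by
      refine hclosed.closure_subset_iff.2 ?_ hcl
      intro s hs
      have h1 := hcon s hs
      simp only [F] at h1
      rw [lt_div_iff₀ (hmpos _ hs)] at h1
      have := hmD (p, s)
      simp only [mem_ofPred_eq]
      nlinarith
    simp only [mem_ofPred_eq] at this
    exact hβO ((hDO _).1 (by by_contra! h; nlinarith))
  have hsurj : ∀ q : P × ℝ, ∃ s, (q.1, s) ∈ O ∧ F (q.1, s) = q.2 := by
    rintro ⟨p, v⟩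
    obtain ⟨s, hs, hsv⟩ := hdown p v
    obtain ⟨s', hs', hsv'⟩ := hup p v
    have hcont : ContinuousOn (fun s => F (p, s)) {s | (p, s) ∈ O} :=
      hF.comp (by fun_prop : Continuous fun s : ℝ => (p, s)).continuousOn fun s hs => hs
    have := (hc p).isPreconnected.intermediate_value hs hs' hcont ⟨hsv, hsv'⟩
    obtain ⟨s, hs, h⟩ := this
    exact ⟨s, hs, h⟩
  choose G hGO hGF using hsurj
  have hFle : ∀ p s s', (p, s) ∈ O → (p, s') ∈ O → F (p, s) < F (p, s') → s < s' := by
    intro p s s' hs hs' h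
    by_contra! hle
    rcases hle.eq_or_lt with rfl | h'
    · exact h.false
    · exact (h.trans (hFmono p s' s hs' hs h')).false
  refine ⟨F, G, hF, ?_, hGO, hGF, ?_⟩
  · rw [continuous_iff_continuousAt]
    rintro ⟨p, v⟩
    have key : ∀ s, (p, s) ∈ O → ContinuousAt (fun q : P × ℝ => F (q.1, s)) (p, v) ∧
        ∀ᶠ q : P × ℝ in 𝓝 (p, v), (q.1, s) ∈ O := by
      intro s hs
      have h1 : Continuous fun q : P × ℝ => (q.1, s) := by fun_prop
      exact ⟨ContinuousAt.comp (f := fun q : P × ℝ => (q.1, s)) (g := F)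
        (hF.continuousAt (hO.mem_nhds hs)) h1.continuousAt,
        h1.continuousAt.preimage_mem_nhds (hO.mem_nhds hs)⟩
    have hop : IsOpen {s | (p, s) ∈ O} := hO.preimage (by fun_prop : Continuous fun s : ℝ => (p, s))
    rw [ContinuousAt, tendsto_order]
    constructor
    · intro a ha
      have : ∀ᶠ s in 𝓝[<] (G (p, v)), a < s ∧ (p, s) ∈ O ∧ s < G (p, v) := by
        filter_upwards [Ioo_mem_nhdsLT ha, nhdsWithin_le_nhds (hop.mem_nhds (hGO (p, v)))]
          with s h1 h2
        exact ⟨h1.1, h2, h1.2⟩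
      obtain ⟨s, has, hsO, hs⟩ := this.exists
      obtain ⟨k1, k2⟩ := key s hsO
      have h3 : F (p, s) < v := by
        have := hFmono p _ _ hsO (hGO (p, v)) hs
        rwa [hGF] at this
      have h4 : ∀ᶠ q : P × ℝ in 𝓝 (p, v), F (q.1, s) < q.2 :=
        k1.eventually_lt continuousAt_snd h3
      filter_upwards [k2, h4] with q h5 h6
      exact has.trans (hFle q.1 _ _ h5 (hGO q) (by rwa [hGF]))
    · intro a ha
      have : ∀ᶠ s in 𝓝[>] (G (p, v)), s < a ∧ (p, s) ∈ O ∧ G (p, v) < s := by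
        filter_upwards [Ioo_mem_nhdsGT ha, nhdsWithin_le_nhds (hop.mem_nhds (hGO (p, v)))]
          with s h1 h2
        exact ⟨h1.2, h2, h1.1⟩
      obtain ⟨s, has, hsO, hs⟩ := this.exists
      obtain ⟨k1, k2⟩ := key s hsO
      have h3 : v < F (p, s) := by
        have := hFmono p _ _ (hGO (p, v)) hsO hs
        rwa [hGF] at this
      have h4 : ∀ᶠ q : P × ℝ in 𝓝 (p, v), q.2 < F (q.1, s) :=
        ContinuousAt.eventually_lt continuousAt_snd k1 h3
      filter_upwards [k2, h4] with q h5 h6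
      exact (hFle q.1 _ _ (hGO q) h5 (by rwa [hGF])).trans has
  · rintro ⟨p, s⟩ hs
    have h1 := hGO (p, F (p, s))
    have h2 := hGF (p, F (p, s))
    rcases lt_trichotomy (G (p, F (p, s))) s with h | h | h
    · exact absurd h2 (hFmono p _ _ h1 hs h).ne
    · exact h
    · exact absurd h2 (hFmono p _ _ hs h1 h).ne'

/-- A decreasing sequence of open sets `P n`, with `P n` depending only on the first `n`
coordinates and with `P (n + 1)` obtained from `P n` by restricting the coordinate `n` to a
nonempty open interval, has an intersection which is fibrewise homeomorphic to the whole space. -/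
theorem exists_homeomorph_iInter_of_interval_tower {B : Type*} [TopologicalSpace B]
    [TopologicalSpace.MetrizableSpace B] (P : ℕ → Set (B × (ℕ → ℝ))) (hP0 : P 0 = univ)
    (hopen : ∀ n, IsOpen (P n))
    (hdep : ∀ n b (ξ η : ℕ → ℝ), (∀ k < n, ξ k = η k) → (b, ξ) ∈ P n → (b, η) ∈ P n)
    (hne : ∀ n b ξ, (b, ξ) ∈ P n → ∃ s, (b, Function.update ξ n s) ∈ P (n + 1))
    (hoc : ∀ n b ξ, OrdConnected {s | (b, Function.update ξ n s) ∈ P (n + 1)}) :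
    ∃ h : (⋂ n, P n : Set (B × (ℕ → ℝ))) ≃ₜ B × (ℕ → ℝ), ∀ x, (h x).1 = x.1.1 := by
  have hupd : ∀ n, Continuous fun q : P n × ℝ =>
      ((q.1.1.1, Function.update q.1.1.2 n q.2) : B × (ℕ → ℝ)) := fun n => by fun_prop
  have htriv := fun n => exists_interval_trivialization (P := P n)
    (O := {q | (q.1.1.1, Function.update q.1.1.2 n q.2) ∈ P (n + 1)})
    ((hopen (n + 1)).preimage (hupd n)) (fun p => hne n _ _ p.2) (fun p => hoc n p.1.1 p.1.2)
  choose F G hF hG hGO hFG hGF using htriv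
  let trunc : ℕ → (ℕ → ℝ) → ℕ → ℝ := fun n ξ k => if k < n then ξ k else 0
  have htc : ∀ n, Continuous (trunc n) := fun n => by
    refine continuous_pi fun k => ?_
    simp only [trunc]
    split_ifs <;> fun_prop
  have htP : ∀ n (x : B × (ℕ → ℝ)), x ∈ P n → (x.1, trunc n x.2) ∈ P n := fun n x hx =>
    hdep n _ _ _ (fun k hk => by simp [trunc, hk]) hx
  let T : ∀ n, (⋂ n, P n : Set (B × (ℕ → ℝ))) → P n := fun n x =>
    ⟨(x.1.1, trunc n x.1.2), htP n _ (mem_iInter.1 x.2 n)⟩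
  have hT : ∀ n, Continuous (T n) := fun n => by
    have := htc n
    exact Continuous.subtype_mk (by fun_prop) _
  have hTO : ∀ n (x : (⋂ n, P n : Set (B × (ℕ → ℝ)))),
      (x.1.1, Function.update (trunc n x.1.2) n (x.1.2 n)) ∈ P (n + 1) := fun n x => by
    refine hdep (n + 1) _ x.1.2 _ (fun k hk => ?_) (mem_iInter.1 x.2 (n + 1))
    rcases (Nat.lt_succ_iff_lt_or_eq.1 hk) with h | rfl
    · simp [trunc, h, h.ne]
    · simp
  let Θ : (⋂ n, P n : Set (B × (ℕ → ℝ))) → B × (ℕ → ℝ) := fun x =>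
    (x.1.1, fun n => F n (T n x, x.1.2 n))
  have hΘ : Continuous Θ := by
    refine (by fun_prop : Continuous fun x : (⋂ n, P n : Set (B × (ℕ → ℝ))) => x.1.1).prodMk
      (continuous_pi fun n => ?_)
    exact (hF n).comp_continuous
      ((hT n).prodMk ((continuous_apply n).comp (continuous_snd.comp continuous_subtype_val)))
      fun x => hTO n x
  let Ξ : ∀ n, {f : B × (ℕ → ℝ) → P n // Continuous f ∧ ∀ x, (f x).1.1 = x.1} := fun n =>
    Nat.rec ⟨fun x => ⟨(x.1, fun _ => 0), by simp [hP0]⟩, by fun_prop, fun x => rfl⟩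
      (fun n f => ⟨fun x => ⟨((f.1 x).1.1,
        Function.update (f.1 x).1.2 n (G n (f.1 x, x.2 n))), hGO n (f.1 x, x.2 n)⟩, by
          have h1 := f.2.1
          have h2 := hG n
          exact ((hupd n).comp (h1.prodMk (h2.comp (h1.prodMk (by fun_prop))))).subtype_mk _,
        f.2.2⟩) n
  have hΞs : ∀ n x, ((Ξ (n + 1)).1 x).1.2 =
      Function.update ((Ξ n).1 x).1.2 n (G n ((Ξ n).1 x, x.2 n)) := fun n x => rfl
  have hΞ1 : ∀ n x, ((Ξ n).1 x).1.1 = x.1 := fun n x => (Ξ n).2.2 x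
  let ξ : B × (ℕ → ℝ) → ℕ → ℝ := fun x n => G n ((Ξ n).1 x, x.2 n)
  have hΞ : ∀ n x, ((Ξ n).1 x).1.2 = trunc n (ξ x) := by
    intro n x
    induction n with
    | zero => funext k; simp [trunc, Ξ]
    | succ n ih =>
      rw [hΞs, ih]
      funext k
      rcases lt_trichotomy k n with h | rfl | h
      · simp [trunc, h, h.ne, h.trans (Nat.lt_succ_self n)]
      · simp [trunc, ξ]
      · simp [trunc, h.ne', not_lt.2 h.le, not_lt.2 (Nat.succ_le_of_lt h)]
  have hξP : ∀ x n, (x.1, ξ x) ∈ P n := fun x n => by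
    refine hdep n _ (trunc n (ξ x)) _ (fun k hk => by simp [trunc, hk]) ?_
    rw [← hΞ, ← hΞ1 n x]
    exact ((Ξ n).1 x).2
  have hξc : Continuous ξ := continuous_pi fun n =>
    (hG n).comp ((Ξ n).2.1.prodMk ((continuous_apply n).comp continuous_snd))
  refine ⟨⟨⟨Θ, fun x => ⟨(x.1, ξ x), mem_iInter.2 (hξP x)⟩, ?_, ?_⟩, hΘ, ?_⟩, fun x => rfl⟩
  · intro x
    apply Subtype.ext
    refine Prod.ext rfl ?_
    have key : ∀ n, trunc n (ξ (Θ x)) = trunc n x.1.2 := by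
      intro n
      induction n with
      | zero => funext k; simp [trunc]
      | succ n ih =>
        have h1 : (Ξ n).1 (Θ x) = T n x := by
          apply Subtype.ext
          exact Prod.ext (hΞ1 n _) ((hΞ n _).trans ih)
        have h2 : ξ (Θ x) n = x.1.2 n := by
          simp only [ξ, h1]
          exact hGF n (T n x, x.1.2 n) (hTO n x)
        funext k
        rcases lt_trichotomy k n with h | rfl | h
        · have := congrFun ih k
          simpa [trunc, h, h.trans (Nat.lt_succ_self n)] using this
        · simpa [trunc] using h2
        · simp [trunc, not_lt.2 (Nat.succ_le_of_lt h)]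
    funext n
    simpa [trunc] using congrFun (key (n + 1)) n
  · intro x
    refine Prod.ext rfl ?_
    funext n
    have h1 : T n ⟨(x.1, ξ x), mem_iInter.2 (hξP x)⟩ = (Ξ n).1 x := by
      apply Subtype.ext
      exact Prod.ext (hΞ1 n x).symm (hΞ n x).symm
    change F n (T n _, ξ x n) = x.2 n
    rw [h1]
    exact hFG n ((Ξ n).1 x, x.2 n)
  · exact (continuous_fst.prodMk hξc).subtype_mk _

/-- The partial sums measuring how well the numbers `ξ (Nat.pair j i)`, `i < m`, track `x`. -/
noncomputable def trackingSum (ξ : ℕ → ℝ) (j m : ℕ) (x : ℝ) : ℝ :=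
  ∑ i ∈ Finset.range m, 2 ^ i * |x - ξ (Nat.pair j i)|

/-- The condition on the coordinate `ξ n`, where `n` codes a pair `(j, m)`: the numbers
`ξ (Nat.pair j i)`, `i ≤ m`, track `x j`. -/
def Tracks (ξ x : ℕ → ℝ) (n : ℕ) : Prop :=
  trackingSum ξ n.unpair.1 (n.unpair.2 + 1) (x n.unpair.1) < 1

theorem trackingSum_succ (ξ : ℕ → ℝ) (j m : ℕ) (x : ℝ) :
    trackingSum ξ j (m + 1) x = trackingSum ξ j m x + 2 ^ m * |x - ξ (Nat.pair j m)| :=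
  Finset.sum_range_succ _ _

theorem trackingSum_congr {ξ η : ℕ → ℝ} {j m : ℕ} (x : ℝ)
    (h : ∀ i < m, ξ (Nat.pair j i) = η (Nat.pair j i)) :
    trackingSum ξ j m x = trackingSum η j m x :=
  Finset.sum_congr rfl fun i hi => by rw [h i (Finset.mem_range.1 hi)]

@[fun_prop]
theorem continuous_trackingSum {X : Type*} [TopologicalSpace X] {ξ : X → ℕ → ℝ} {x : X → ℝ}
    (hξ : Continuous ξ) (hx : Continuous x) (j m : ℕ) :
    Continuous fun a => trackingSum (ξ a) j m (x a) := by
  unfold trackingSum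
  fun_prop

theorem trackingSum_le_max (ξ : ℕ → ℝ) (j m : ℕ) {x y z : ℝ} (hz : z ∈ uIcc x y) :
    trackingSum ξ j m z ≤ max (trackingSum ξ j m x) (trackingSum ξ j m y) := by
  have hconv : ConvexOn ℝ univ (trackingSum ξ j m) := by
    induction m with
    | zero =>
      have : trackingSum ξ j 0 = fun _ => 0 := by funext x; simp [trackingSum]
      rw [this]
      exact convexOn_const 0 convex_univ
    | succ m ih =>
      have : trackingSum ξ j (m + 1) =
          trackingSum ξ j m + fun x => (2 : ℝ) ^ m • |x - ξ (Nat.pair j m)| := by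
        funext x
        simp [trackingSum_succ]
      rw [this]
      refine ih.add (ConvexOn.smul (by positivity) ?_)
      have h := (convexOn_norm (E := ℝ) convex_univ).translate_left (-ξ (Nat.pair j m))
      simpa [Function.comp_def, sub_eq_add_neg] using h
  rw [← segment_eq_uIcc] at hz
  exact hconv.le_max_of_mem_segment (mem_univ _) (mem_univ _) hz

theorem abs_trackingSum_sub_le (ξ : ℕ → ℝ) (j m : ℕ) (x y : ℝ) :
    |trackingSum ξ j m x - trackingSum ξ j m y| ≤ (2 ^ m - 1) * |x - y| := by
  induction m with
  | zero => simp [trackingSum]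
  | succ m ih =>
    rw [trackingSum_succ, trackingSum_succ]
    have h : |(2 : ℝ) ^ m * |x - ξ (Nat.pair j m)| - 2 ^ m * (|y - ξ (Nat.pair j m)|)|
        ≤ 2 ^ m * |x - y| := by
      rw [← mul_sub, abs_mul, abs_of_nonneg (by positivity : (0 : ℝ) ≤ 2 ^ m)]
      refine mul_le_mul_of_nonneg_left ?_ (by positivity)
      have h1 := abs_abs_sub_abs_le (x - ξ (Nat.pair j m)) (y - ξ (Nat.pair j m))
      rwa [sub_sub_sub_cancel_right] at h1
    calc _ = |(trackingSum ξ j m x - trackingSum ξ j m y) +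
          ((2 : ℝ) ^ m * |x - ξ (Nat.pair j m)| - 2 ^ m * |y - ξ (Nat.pair j m)|)| := by ring_nf
      _ ≤ _ := abs_add_le _ _
      _ ≤ (2 ^ m - 1) * |x - y| + 2 ^ m * |x - y| := add_le_add ih h
      _ = _ := by ring

theorem trackingSum_nonneg (ξ : ℕ → ℝ) (j m : ℕ) (x : ℝ) : 0 ≤ trackingSum ξ j m x :=
  Finset.sum_nonneg fun i _ => by positivity

theorem tracks_congr {ξ η x : ℕ → ℝ} {n : ℕ} (h : ∀ k ≤ n, ξ k = η k) :
    Tracks ξ x n ↔ Tracks η x n := by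
  unfold Tracks
  rw [trackingSum_congr (ξ := ξ) (η := η)]
  intro i hi
  refine h _ ?_
  calc Nat.pair n.unpair.1 i ≤ Nat.pair n.unpair.1 n.unpair.2 := by
        rcases (Nat.lt_succ_iff.1 hi).eq_or_lt with h | h
        · rw [h]
        · exact (Nat.pair_lt_pair_right _ h).le
    _ = n := Nat.pair_unpair n

theorem tracks_update_of_lt {ξ x : ℕ → ℝ} {k n : ℕ} (h : k < n) (s : ℝ) :
    Tracks (Function.update ξ n s) x k ↔ Tracks ξ x k :=
  tracks_congr fun i hi => by simp [(hi.trans_lt h).ne]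

theorem tracks_update_self {ξ x : ℕ → ℝ} {n : ℕ} (s : ℝ) :
    Tracks (Function.update ξ n s) x n ↔
      trackingSum ξ n.unpair.1 n.unpair.2 (x n.unpair.1) +
        2 ^ n.unpair.2 * |x n.unpair.1 - s| < 1 := by
  unfold Tracks
  rw [trackingSum_succ, Nat.pair_unpair, Function.update_self,
    trackingSum_congr (η := ξ)]
  intro i hi
  have : Nat.pair n.unpair.1 i < n := by
    conv_rhs => rw [← Nat.pair_unpair n]
    exact Nat.pair_lt_pair_right _ hi
  simp [this.ne]

theorem trackingSum_lt_one {ξ x : ℕ → ℝ} {n : ℕ} (h : ∀ k < n, Tracks ξ x k) :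
    trackingSum ξ n.unpair.1 n.unpair.2 (x n.unpair.1) < 1 := by
  rcases hm : n.unpair.2 with _ | m
  · simp [trackingSum]
  · have hlt : Nat.pair n.unpair.1 m < n := by
      conv_rhs => rw [← Nat.pair_unpair n, hm]
      exact Nat.pair_lt_pair_right _ (Nat.lt_succ_self m)
    simpa [Tracks] using h _ hlt

theorem forall_tracks_update_iff {ξ x : ℕ → ℝ} {n : ℕ} (s : ℝ) :
    (∀ k < n + 1, Tracks (Function.update ξ n s) x k) ↔ (∀ k < n, Tracks ξ x k) ∧
      trackingSum ξ n.unpair.1 n.unpair.2 (x n.unpair.1) +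
        2 ^ n.unpair.2 * |x n.unpair.1 - s| < 1 := by
  rw [Nat.forall_lt_succ_right, tracks_update_self]
  exact and_congr_left fun _ => forall₂_congr fun k hk => tracks_update_of_lt hk s

theorem abs_sub_lt_of_tracks {ξ x : ℕ → ℝ} {j m : ℕ} (h : Tracks ξ x (Nat.pair j m)) :
    |x j - ξ (Nat.pair j m)| < (1 / 2) ^ m := by
  simp only [Tracks, Nat.unpair_pair, trackingSum_succ] at h
  have h1 := trackingSum_nonneg ξ j m (x j)
  have h2 : 2 ^ m * |x j - ξ (Nat.pair j m)| < 1 := by linarith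
  rw [one_div, inv_pow, ← one_div, lt_div_iff₀ (by positivity)]
  linarith

/-- If approximations of `x` satisfy more and more of the tracking conditions, then `x` satisfies
all of them (with strict inequalities). -/
theorem tracks_of_tendsto {ξ x : ℕ → ℝ} {y : ℕ → ℕ → ℝ}
    (hy : ∀ n, ∀ k < n, Tracks ξ (y n) k) (hx : ∀ j, Tendsto (fun n => y n j) atTop (𝓝 (x j)))
    (n : ℕ) : Tracks ξ x n := by
  obtain ⟨j, m, rfl⟩ : ∃ j m, n = Nat.pair j m := ⟨_, _, (Nat.pair_unpair n).symm⟩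
  have hev : ∀ m, ∀ᶠ n in atTop, trackingSum ξ j (m + 1) (y n j) < 1 := fun m => by
    filter_upwards [eventually_gt_atTop (Nat.pair j m)] with n hn
    simpa [Tracks] using hy n _ hn
  have hle : ∀ m, trackingSum ξ j (m + 1) (x j) ≤ 1 := fun m => by
    have hc : Continuous fun z : ℝ => trackingSum ξ j (m + 1) z := by fun_prop
    exact le_of_tendsto ((hc.tendsto _).comp (hx j)) ((hev m).mono fun n hn => hn.le)
  simp only [Tracks, Nat.unpair_pair]
  refine lt_of_le_of_ne (hle m) fun heq => ?_
  have h1 := hle (m + 1)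
  rw [trackingSum_succ, heq] at h1
  have h2 : x j = ξ (Nat.pair j (m + 1)) := by
    have h3 : |x j - ξ (Nat.pair j (m + 1))| ≤ 0 := by
      have : (0 : ℝ) < 2 ^ (m + 1) := by positivity
      by_contra! h
      nlinarith [mul_pos this h]
    exact sub_eq_zero.1 (abs_nonpos_iff.1 h3)
  obtain ⟨n, hn⟩ := (hev (m + 1)).exists
  rw [trackingSum_succ, ← h2] at hn
  have h3 := abs_trackingSum_sub_le ξ j (m + 1) (x j) (y n j)
  rw [heq, abs_sub_comm (x j)] at h3
  have h4 := le_abs_self (1 - trackingSum ξ j (m + 1) (y n j))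
  have h5 := abs_nonneg (y n j - x j)
  nlinarith

/-- A parametrised factor theorem: an open map with suitably coordinatised, complete fibres
becomes a trivial bundle after multiplication with `ℕ → ℝ`. -/
theorem exists_homeomorph_prod_of_coordinates {E B : Type*} [TopologicalSpace E]
    [TopologicalSpace B] [TopologicalSpace.MetrizableSpace B] {p : E → B} (hp : Continuous p)
    (hpo : IsOpenMap p) (hps : Function.Surjective p) (φ : E → ℕ → ℝ) (hφ : IsEmbedding φ)
    (hconn : ∀ e₁ e₂ j s, p e₁ = p e₂ → φ e₁ j ≤ s → s ≤ φ e₂ j →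
      ∃ e, p e = p e₁ ∧ φ e j = s ∧ ∀ k, φ e k ∈ uIcc (φ e₁ k) (φ e₂ k))
    (hcomp : ∀ (b : B) (e : ℕ → E) (x : ℕ → ℝ), (∀ n, p (e n) = b) →
      (∀ j, Tendsto (fun n => φ (e n) j) atTop (𝓝 (x j))) → ∃ e', p e' = b ∧ φ e' = x) :
    ∃ h : E × (ℕ → ℝ) ≃ₜ B × (ℕ → ℝ), ∀ x, (h x).1 = p x.1 := by
  have : TopologicalSpace.MetrizableSpace E := hφ.metrizableSpace
  have hφc := hφ.continuous
  let Q : ℕ → Set (E × (ℕ → ℝ)) := fun n => {x | ∀ k < n, Tracks x.2 (φ x.1) k}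
  let P : ℕ → Set (B × (ℕ → ℝ)) := fun n => {x | ∃ e, p e = x.1 ∧ ∀ k < n, Tracks x.2 (φ e) k}
  have hQo : ∀ n, IsOpen (Q n) := fun n => by
    have : Q n = ⋂ k ∈ Finset.range n, {x | Tracks x.2 (φ x.1) k} := by
      ext x; simp [Q]
    rw [this]
    refine isOpen_biInter_finset fun k _ => ?_
    exact isOpen_lt (by fun_prop) continuous_const
  have hPo : ∀ n, IsOpen (P n) := fun n => by
    have : P n = Prod.map p id '' Q n := by
      ext ⟨b, ξ⟩
      constructor
      · rintro ⟨e, he, h⟩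
        exact ⟨(e, ξ), h, Prod.ext he rfl⟩
      · rintro ⟨⟨e, η⟩, h, heq⟩
        simp only [Prod.map_apply, id_eq, Prod.mk.injEq] at heq
        obtain ⟨rfl, rfl⟩ := heq
        exact ⟨e, rfl, h⟩
    rw [this]
    exact (hpo.prodMap IsOpenMap.id) _ (hQo n)
  obtain ⟨hE, hE1⟩ := exists_homeomorph_iInter_of_interval_tower Q (by ext; simp [Q]) hQo
    (fun n e ξ η h hQ k hk =>
      (tracks_congr fun i hi => h i (hi.trans_lt hk)).1 (hQ k hk))
    (fun n e ξ h => ⟨φ e n.unpair.1, (forall_tracks_update_iff _).2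
      ⟨h, by simpa using trackingSum_lt_one h⟩⟩)
    (fun n e ξ => ⟨by
      intro s₁ h₁ s₂ h₂ s hs
      have h₁ := (forall_tracks_update_iff _).1 h₁
      have h₂ := (forall_tracks_update_iff _).1 h₂
      refine (forall_tracks_update_iff _).2 ⟨h₁.1, ?_⟩
      have hpos : (0 : ℝ) < 2 ^ n.unpair.2 := by positivity
      have : |φ e n.unpair.1 - s| ≤ |φ e n.unpair.1 - s₁| ∨
          |φ e n.unpair.1 - s| ≤ |φ e n.unpair.1 - s₂| := by
        rcases le_total s (φ e n.unpair.1) with h | h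
        · left
          rw [abs_of_nonneg (by linarith), abs_of_nonneg (by linarith [hs.1])]
          linarith [hs.1]
        · right
          rw [abs_of_nonpos (by linarith), abs_of_nonpos (by linarith [hs.2])]
          linarith [hs.2]
      rcases this with h | h
      · exact lt_of_le_of_lt (by gcongr) h₁.2
      · exact lt_of_le_of_lt (by gcongr) h₂.2⟩)
  obtain ⟨hB, hB1⟩ := exists_homeomorph_iInter_of_interval_tower P
    (by
      ext x
      obtain ⟨e, he⟩ := hps x.1
      simpa [P] using ⟨e, he⟩) hPo
    (fun n b ξ η h hP => by
      obtain ⟨e, he, hP⟩ := hP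
      exact ⟨e, he, fun k hk => (tracks_congr fun i hi => h i (hi.trans_lt hk)).1 (hP k hk)⟩)
    (fun n b ξ h => by
      obtain ⟨e, he, h⟩ := h
      exact ⟨φ e n.unpair.1, e, he, (forall_tracks_update_iff _).2
        ⟨h, by simpa using trackingSum_lt_one h⟩⟩)
    (fun n b ξ => ⟨by
      rintro s₁ ⟨e₁, he₁, h₁⟩ s₂ ⟨e₂, he₂, h₂⟩ s hs
      have h₁ := (forall_tracks_update_iff _).1 h₁
      have h₂ := (forall_tracks_update_iff _).1 h₂
      have hpos : (0 : ℝ) < 2 ^ n.unpair.2 := by positivity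
      rcases le_total s (φ e₁ n.unpair.1) with h | h
      · refine ⟨e₁, he₁, (forall_tracks_update_iff _).2 ⟨h₁.1, lt_of_le_of_lt ?_ h₁.2⟩⟩
        rw [abs_of_nonneg (by linarith), abs_of_nonneg (by linarith [hs.1])]
        gcongr
        exact hs.1
      rcases le_total s (φ e₂ n.unpair.1) with h' | h'
      · obtain ⟨e, he, hes, hek⟩ := hconn e₁ e₂ n.unpair.1 s (he₁.trans he₂.symm) h h'
        have htr : ∀ k < n, Tracks ξ (φ e) k := fun k hk =>
          (trackingSum_le_max _ _ _ (hek _)).trans_lt (max_lt (h₁.1 k hk) (h₂.1 k hk))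
        refine ⟨e, he.trans he₁, (forall_tracks_update_iff _).2 ⟨htr, ?_⟩⟩
        simpa [hes] using trackingSum_lt_one htr
      · refine ⟨e₂, he₂, (forall_tracks_update_iff _).2 ⟨h₂.1, lt_of_le_of_lt ?_ h₂.2⟩⟩
        rw [abs_of_nonpos (by linarith), abs_of_nonpos (by linarith [hs.2])]
        gcongr
        exact hs.2⟩)
  have hQtr : ∀ x : (⋂ n, Q n : Set (E × (ℕ → ℝ))), ∀ k, Tracks x.1.2 (φ x.1.1) k :=
    fun x k => mem_iInter.1 x.2 (k + 1) k (Nat.lt_succ_self k)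
  let f : (⋂ n, Q n : Set (E × (ℕ → ℝ))) → (⋂ n, P n : Set (B × (ℕ → ℝ))) := fun x =>
    ⟨(p x.1.1, x.1.2), mem_iInter.2 fun n => ⟨x.1.1, rfl, fun k _ => hQtr x k⟩⟩
  have hf : Continuous f := Continuous.subtype_mk (by fun_prop) _
  have hpow : Tendsto (fun m : ℕ => (1 / 2 : ℝ) ^ m) atTop (𝓝 0) :=
    tendsto_pow_atTop_nhds_zero_of_lt_one (by norm_num) (by norm_num)
  have hlim : ∀ (ξ x : ℕ → ℝ), (∀ k, Tracks ξ x k) → ∀ j,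
      Tendsto (fun m => ξ (Nat.pair j m)) atTop (𝓝 (x j)) := by
    intro ξ x h j
    rw [tendsto_iff_dist_tendsto_zero]
    refine squeeze_zero (fun _ => dist_nonneg) (fun m => ?_) hpow
    rw [dist_comm]
    exact (abs_sub_lt_of_tracks (h _)).le
  have hsurj : ∀ y : (⋂ n, P n : Set (B × (ℕ → ℝ))), ∃ e, p e = y.1.1 ∧
      ∀ k, Tracks y.1.2 (φ e) k := by
    rintro ⟨⟨b, ξ⟩, hy⟩
    choose e he htr using mem_iInter.1 hy
    have hcau : ∀ j, ∃ x, Tendsto (fun n => φ (e n) j) atTop (𝓝 x) := by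
      intro j
      refine cauchySeq_tendsto_of_complete (Metric.cauchySeq_iff'.2 fun ε hε => ?_)
      obtain ⟨m, hm⟩ := ((tendsto_order.1 hpow).2 (ε / 2) (by linarith)).exists
      refine ⟨Nat.pair j m + 1, fun n hn => ?_⟩
      have h1 := abs_sub_lt_of_tracks (htr n (Nat.pair j m) hn)
      have h2 := abs_sub_lt_of_tracks (htr (Nat.pair j m + 1) (Nat.pair j m) (Nat.lt_succ_self _))
      rw [Real.dist_eq]
      rw [abs_lt] at *
      constructor <;> linarith [h1.1, h1.2, h2.1, h2.2]
    choose x hx using hcau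
    obtain ⟨e', he', hφe'⟩ := hcomp b e x he hx
    exact ⟨e', he', hφe' ▸ tracks_of_tendsto htr hx⟩
  choose r hrp hr using hsurj
  have hrc : Continuous r := by
    rw [hφ.continuous_iff]
    refine continuous_pi fun j => ?_
    have hu : TendstoUniformly
        (fun (m : ℕ) (y : (⋂ n, P n : Set (B × (ℕ → ℝ)))) => y.1.2 (Nat.pair j m))
        (fun y => φ (r y) j) atTop := by
      rw [Metric.tendstoUniformly_iff]
      intro ε hε
      filter_upwards [(tendsto_order.1 hpow).2 ε hε] with m hm y
      exact (abs_sub_lt_of_tracks (hr y _)).trans hm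
    exact hu.continuous (Frequently.of_forall fun m => by fun_prop)
  let g : (⋂ n, Q n : Set (E × (ℕ → ℝ))) ≃ₜ (⋂ n, P n : Set (B × (ℕ → ℝ))) :=
    { toFun := f
      invFun := fun y => ⟨(r y, y.1.2), mem_iInter.2 fun n k _ => hr y k⟩
      left_inv := fun x => by
        have h1 : r (f x) = x.1.1 := by
          apply hφ.injective
          funext j
          exact tendsto_nhds_unique (hlim _ _ (hr (f x)) j) (hlim _ _ (hQtr x) j)
        apply Subtype.ext
        exact Prod.ext h1 rfl
      right_inv := fun y => Subtype.ext (Prod.ext (hrp y) rfl)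
      continuous_toFun := hf
      continuous_invFun := Continuous.subtype_mk (by fun_prop) _ }
  refine ⟨hE.symm.trans (g.trans hB), fun x => ?_⟩
  have h1 : (hE.symm x).1.1 = x.1 := by
    rw [← hE1, hE.apply_symm_apply]
  simp only [Homeomorph.trans_apply, hB1]
  change p (hE.symm x).1.1 = _
  rw [h1]

/-- The hyperspace of nonempty compact max-plus convex subsets of `κ → ℝ`. -/
def Mpc (κ : Type*) : Type _ :=
  {A : Set (κ → ℝ) // A.Nonempty ∧ IsCompact A ∧ MaxPlusConvex A}

namespace Mpc

variable {κ κ' κ'' : Type*}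

instance : TopologicalSpace (Mpc κ) := vietoris _

instance : SetLike (Mpc κ) (κ → ℝ) where
  coe A := A.1
  coe_injective := Subtype.val_injective

theorem nonempty (A : Mpc κ) : (A : Set (κ → ℝ)).Nonempty := A.2.1

theorem isCompact (A : Mpc κ) : IsCompact (A : Set (κ → ℝ)) := A.2.2.1

theorem max_mem (A : Mpc κ) {a b : κ → ℝ} (ha : a ∈ A) (hb : b ∈ A) {t : ℝ} (ht : t ≤ 0) :
    (fun i => max (a i) (t + b i)) ∈ A := A.2.2.2 a ha b hb t ht

/-- Forgetting convexity and nonemptiness. -/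
def toCompacts (A : Mpc κ) : Compacts (κ → ℝ) := ⟨A, A.isCompact⟩

theorem isEmbedding_toCompacts : IsEmbedding (toCompacts (κ := κ)) where
  injective A B h := SetLike.coe_injective
    (show (A.toCompacts : Set (κ → ℝ)) = B.toCompacts by rw [h])
  eq_induced := by
    let := TopologicalSpace.vietoris (κ → ℝ)
    rw [Compacts.isEmbedding_coe.eq_induced, induced_compose, TopologicalSpace.vietoris,
      induced_generateFrom_eq]
    change generateFrom _ = _
    congr 1
    ext S
    constructor
    · rintro ⟨U, hU, rfl | rfl⟩
      · exact ⟨_, Or.inl ⟨U, hU, rfl⟩, rfl⟩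
      · exact ⟨_, Or.inr ⟨U, hU, rfl⟩, rfl⟩
    · rintro ⟨_, ⟨U, hU, rfl⟩ | ⟨U, hU, rfl⟩, rfl⟩
      · exact ⟨U, hU, Or.inl rfl⟩
      · exact ⟨U, hU, Or.inr rfl⟩

instance : T2Space (Mpc κ) := isEmbedding_toCompacts.t2Space

theorem isOpen_subset {U : Set (κ → ℝ)} (hU : IsOpen U) :
    IsOpen {A : Mpc κ | (A : Set (κ → ℝ)) ⊆ U} :=
  isOpen_generateFrom_of_mem ⟨U, hU, Or.inl rfl⟩

theorem isOpen_inter_nonempty {U : Set (κ → ℝ)} (hU : IsOpen U) :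
    IsOpen {A : Mpc κ | ((A : Set (κ → ℝ)) ∩ U).Nonempty} :=
  isOpen_generateFrom_of_mem ⟨U, hU, Or.inr rfl⟩

/-- Points that are `ε`-close in the coordinates belonging to `F`. -/
def closeRel (F : Finset κ) (ε : ℝ) : Set ((κ → ℝ) × (κ → ℝ)) :=
  {p | ∀ i ∈ F, |p.1 i - p.2 i| < ε}

theorem hasBasis_uniformity_closeRel :
    (uniformity (κ → ℝ)).HasBasis (fun p : Finset κ × ℝ => 0 < p.2)
      (fun p => closeRel p.1 p.2) := by
  classical
  rw [Pi.uniformity]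
  refine ⟨fun s => ?_⟩
  have hb := HasBasis.iInf' (fun i : κ => (Metric.uniformity_basis_dist (α := ℝ)).comap
    (fun a : (κ → ℝ) × (κ → ℝ) => (a.1 i, a.2 i)))
  rw [hb.mem_iff]
  constructor
  · rintro ⟨⟨I, f⟩, ⟨hI, hf⟩, hs⟩
    lift I to Finset κ using hI
    dsimp only at hf hs
    have : ∃ ε : ℝ, 0 < ε ∧ ∀ i ∈ I, ε ≤ f i := by
      rcases I.eq_empty_or_nonempty with rfl | hne
      · exact ⟨1, one_pos, by simp⟩
      · exact ⟨I.inf' hne f, (Finset.lt_inf'_iff _).2 (fun i hi => hf i hi),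
          fun i hi => Finset.inf'_le _ hi⟩
    obtain ⟨ε, hε, hle⟩ := this
    refine ⟨⟨I, ε⟩, hε, Subset.trans (fun p hp => ?_) hs⟩
    simp only [mem_iInter]
    intro i hi
    exact (hp i hi).trans_le (hle i hi)
  · rintro ⟨⟨I, ε⟩, hε, hs⟩
    refine ⟨⟨I, fun _ => ε⟩, ⟨I.finite_toSet, fun _ _ => hε⟩, Subset.trans ?_ hs⟩
    intro p hp i hi
    simp only [mem_iInter] at hp
    exact hp i hi

/-- Hausdorff closeness of two sets with respect to finitely many coordinates. -/
def Close (F : Finset κ) (ε : ℝ) (A B : Mpc κ) : Prop :=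
  (∀ a ∈ A, ∃ b ∈ B, ∀ i ∈ F, |a i - b i| < ε) ∧ ∀ b ∈ B, ∃ a ∈ A, ∀ i ∈ F, |a i - b i| < ε

theorem hasBasis_nhds (A : Mpc κ) :
    (𝓝 A).HasBasis (fun p : Finset κ × ℝ => 0 < p.2) (fun p => {B | Close p.1 p.2 A B}) := by
  rw [isEmbedding_toCompacts.nhds_eq_comap, UniformSpace.nhds_eq_comap_uniformity]
  refine (((hasBasis_uniformity_closeRel.uniformity_compacts).comap _).comap _).to_hasBasis
    (fun p hp => ⟨p, hp, fun B hB => hB⟩) (fun p hp => ⟨p, hp, fun B hB => hB⟩)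

theorem mem_nhds_iff {A : Mpc κ} {W : Set (Mpc κ)} :
    W ∈ 𝓝 A ↔ ∃ F : Finset κ, ∃ ε > 0, ∀ B, Close F ε A B → B ∈ W := by
  rw [A.hasBasis_nhds.mem_iff]
  simp [Prod.exists, subset_def]

theorem isClosed_range_toCompacts :
    IsClosed (range (toCompacts (κ := κ))) := by
  rw [← isOpen_compl_iff, isOpen_iff_mem_nhds]
  intro K hK
  by_cases hne : (K : Set (κ → ℝ)).Nonempty
  · have hc : ¬ MaxPlusConvex (K : Set (κ → ℝ)) := fun hc => hK ⟨⟨K, hne, K.isCompact, hc⟩, rfl⟩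
    simp only [MaxPlusConvex, not_forall] at hc
    obtain ⟨a, ha, b, hb, t, ht, hx⟩ := hc
    obtain ⟨W, V, hW, hV, hKW, hxV, hd⟩ :=
      SeparatedNhds.of_isCompact_isCompact K.isCompact isCompact_singleton
        (disjoint_singleton_right.2 hx)
    have hm : Continuous fun p : (κ → ℝ) × (κ → ℝ) => fun i => max (p.1 i) (t + p.2 i) := by
      fun_prop
    have hpre : (fun p : (κ → ℝ) × (κ → ℝ) => fun i => max (p.1 i) (t + p.2 i)) ⁻¹' V ∈ 𝓝 (a, b) :=
      (hV.preimage hm).mem_nhds (hxV rfl)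
    obtain ⟨U₁, U₂, hU₁, ha₁, hU₂, hb₂, hsub⟩ := mem_nhds_prod_iff'.1 hpre
    filter_upwards [(Compacts.isOpen_subsets_of_isOpen hW).mem_nhds hKW,
      (Compacts.isOpen_inter_nonempty_of_isOpen hU₁).mem_nhds ⟨a, ha, ha₁⟩,
      (Compacts.isOpen_inter_nonempty_of_isOpen hU₂).mem_nhds ⟨b, hb, hb₂⟩]
    rintro _ hLW ⟨a', ha', haU⟩ ⟨b', hb', hbU⟩ ⟨A, rfl⟩
    exact disjoint_left.1 hd (hLW (A.max_mem ha' hb' ht)) (hsub (mk_mem_prod haU hbU))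
  · filter_upwards [(Compacts.isOpen_subsets_of_isOpen isOpen_empty).mem_nhds
      (not_nonempty_iff_eq_empty.1 hne).subset]
    rintro _ hL ⟨A, rfl⟩
    exact A.nonempty.ne_empty (subset_empty_iff.1 hL)

theorem isCompact_setOf_subset {K : Set (κ → ℝ)} (hK : IsCompact K) :
    IsCompact {A : Mpc κ | (A : Set (κ → ℝ)) ⊆ K} :=
  (IsClosedEmbedding.mk isEmbedding_toCompacts isClosed_range_toCompacts).isCompact_preimage
    (Compacts.isCompact_subsets_of_isCompact hK)

/-- The map of hyperspaces induced by precomposition with `e`. -/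
def res (e : κ → κ') (A : Mpc κ') : Mpc κ :=
  ⟨(fun x => x ∘ e) '' (A : Set (κ' → ℝ)), A.nonempty.image _,
    A.isCompact.image (by fun_prop), by
      rintro _ ⟨a, ha, rfl⟩ _ ⟨b, hb, rfl⟩ t ht
      exact ⟨_, A.max_mem ha hb ht, rfl⟩⟩

theorem comp_mem_res (e : κ → κ') {A : Mpc κ'} {x : κ' → ℝ} (hx : x ∈ A) : x ∘ e ∈ res e A :=
  ⟨x, hx, rfl⟩

theorem res_res (e : κ → κ') (f : κ' → κ'') (A : Mpc κ'') : res e (res f A) = res (f ∘ e) A :=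
  SetLike.coe_injective (image_image _ _ _)

theorem res_id (A : Mpc κ) : res id A = A :=
  SetLike.coe_injective (image_id _)

theorem continuous_res (e : κ → κ') : Continuous (res e) := by
  rw [isEmbedding_toCompacts.continuous_iff]
  exact (Continuous.compacts_map (f := fun x : κ' → ℝ => x ∘ e) (by fun_prop)).comp
    isEmbedding_toCompacts.continuous

theorem surjective_res {e : κ → κ'} (he : Function.Injective e) : Function.Surjective (res e) := by
  intro B
  have hcont : Continuous fun x : κ → ℝ => Function.extend e x 0 := by
    refine continuous_pi fun k => ?_
    by_cases hk : ∃ i, e i = k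
    · obtain ⟨i, rfl⟩ := hk
      simpa [he.extend_apply] using continuous_apply i
    · simpa [Function.extend_apply' _ _ _ hk] using continuous_const
  refine ⟨⟨(fun x => Function.extend e x (0 : κ' → ℝ)) '' (B : Set (κ → ℝ)), B.nonempty.image _,
    B.isCompact.image hcont, ?_⟩, ?_⟩
  · rintro _ ⟨a, ha, rfl⟩ _ ⟨b, hb, rfl⟩ t ht
    refine ⟨_, B.max_mem ha hb ht, funext fun k => ?_⟩
    by_cases hk : ∃ i, e i = k
    · obtain ⟨i, rfl⟩ := hk
      simp [he.extend_apply]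
    · simp [Function.extend_apply' _ _ _ hk, ht]
  · apply SetLike.coe_injective
    change (fun x => x ∘ e) '' ((fun x => Function.extend e x (0 : κ' → ℝ)) '' (B : Set (κ → ℝ))) =
      B
    rw [image_image]
    simp [Function.extend_comp he]

theorem abs_max_add_sub_max_add_le {a b c d t ε : ℝ} (hac : |a - c| ≤ ε) (hbd : |b - d| ≤ ε) :
    |max a (t + b) - max c (t + d)| ≤ ε :=
  (abs_max_sub_max_le_max _ _ _ _).trans (max_le hac (by simpa using hbd))

theorem isOpenMap_res {e : κ → κ'} (he : Function.Injective e) : IsOpenMap (res e) := by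
  classical
  rw [isOpenMap_iff_nhds_le]
  intro A W hW
  obtain ⟨F, ε, hε, hF⟩ := mem_nhds_iff.1 (mem_map.1 hW)
  refine mem_nhds_iff.2 ⟨F.preimage e he.injOn, ε / 2, half_pos hε, fun B hB => ?_⟩
  let g : (κ → ℝ) × (κ' → ℝ) → κ' → ℝ := fun p => Function.extend e p.1 p.2
  have gl : ∀ p i, g p (e i) = p.1 i := fun p i => he.extend_apply _ _ _
  have gr : ∀ p k, (¬ ∃ i, e i = k) → g p k = p.2 k := fun p k hk =>
    Function.extend_apply' _ _ _ hk
  have hg : Continuous g := by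
    refine continuous_pi fun k => ?_
    by_cases hk : ∃ i, e i = k
    · obtain ⟨i, rfl⟩ := hk
      simp only [gl]
      fun_prop
    · simp only [gr _ _ hk]
      fun_prop
  let S : Set ((κ → ℝ) × (κ' → ℝ)) :=
    {p | p.1 ∈ B ∧ p.2 ∈ A ∧ ∀ i, e i ∈ F → |p.1 i - p.2 (e i)| ≤ ε / 2}
  have hS : IsCompact S := by
    have : S = ((B : Set (κ → ℝ)) ×ˢ (A : Set (κ' → ℝ))) ∩
        ⋂ i, ⋂ (_ : e i ∈ F), {p | |p.1 i - p.2 (e i)| ≤ ε / 2} := by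
      ext p
      simp [S, and_assoc]
    rw [this]
    refine (B.isCompact.prod A.isCompact).inter_right (isClosed_iInter fun i => isClosed_iInter
      fun _ => isClosed_le (by fun_prop) continuous_const)
  have hex₁ : ∀ a ∈ A, ∃ b, (b, a) ∈ S := by
    intro a ha
    obtain ⟨b, hb, hab⟩ := hB.1 _ (comp_mem_res e ha)
    refine ⟨b, hb, ha, fun i hi => ?_⟩
    rw [abs_sub_comm]
    exact (hab i (by simpa using hi)).le
  have hex₂ : ∀ b ∈ B, ∃ a, (b, a) ∈ S := by
    intro b hb
    obtain ⟨_, ⟨a, ha, rfl⟩, hab⟩ := hB.2 b hb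
    refine ⟨a, hb, ha, fun i hi => ?_⟩
    rw [abs_sub_comm]
    exact (hab i (by simpa using hi)).le
  have hclose : ∀ p ∈ S, ∀ k ∈ F, |p.2 k - g p k| < ε := by
    rintro p hp k hk
    by_cases hk' : ∃ i, e i = k
    · obtain ⟨i, rfl⟩ := hk'
      rw [gl, abs_sub_comm]
      exact (hp.2.2 i hk).trans_lt (half_lt_self hε)
    · simpa [gr _ _ hk'] using hε
  let C : Mpc κ' := ⟨g '' S, by
      obtain ⟨a, ha⟩ := A.nonempty
      obtain ⟨b, hb⟩ := hex₁ a ha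
      exact ⟨_, _, hb, rfl⟩, hS.image hg, by
      rintro _ ⟨p, hp, rfl⟩ _ ⟨q, hq, rfl⟩ t ht
      refine ⟨(_, _), ⟨B.max_mem hp.1 hq.1 ht, A.max_mem hp.2.1 hq.2.1 ht, fun i hi =>
        abs_max_add_sub_max_add_le (hp.2.2 i hi) (hq.2.2 i hi)⟩, funext fun k => ?_⟩
      by_cases hk' : ∃ i, e i = k
      · obtain ⟨i, rfl⟩ := hk'
        simp only [gl]
      · simp only [gr _ _ hk']⟩
  have hC : res e C = B := by
    apply SetLike.coe_injective
    change (fun x => x ∘ e) '' (g '' S) = B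
    have hge : ∀ p, g p ∘ e = p.1 := fun p => funext (gl p)
    simp only [image_image, hge]
    ext b
    constructor
    · rintro ⟨p, hp, rfl⟩
      exact hp.1
    · intro hb
      obtain ⟨a, ha⟩ := hex₂ b hb
      exact ⟨_, ha, rfl⟩
  rw [← hC]
  refine hF C ⟨fun a ha => ?_, ?_⟩
  · obtain ⟨b, hb⟩ := hex₁ a ha
    exact ⟨_, ⟨_, hb, rfl⟩, hclose _ hb⟩
  · rintro _ ⟨p, hp, rfl⟩
    exact ⟨p.2, hp.2.1, hclose _ hp⟩

/-- Continuous functions whose sublevel sets are max-plus convex. -/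
structure QuasiConvex (G : (κ → ℝ) → ℝ) : Prop where
  continuous : Continuous G
  le_max : ∀ a b t, t ≤ 0 → G (fun i => max (a i) (t + b i)) ≤ max (G a) (G b)

/-- The supremum of a function over a set. -/
noncomputable def supp (G : (κ → ℝ) → ℝ) (A : Mpc κ) : ℝ := sSup (G '' A)

section supp

variable {G : (κ → ℝ) → ℝ}

theorem exists_mem_eq_supp (hG : Continuous G) (A : Mpc κ) : ∃ a ∈ A, G a = supp G A := by
  obtain ⟨a, ha, h⟩ := A.isCompact.exists_sSup_image_eq A.nonempty hG.continuousOn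
  exact ⟨a, ha, h.symm⟩

theorem le_supp (hG : Continuous G) {A : Mpc κ} {a : κ → ℝ} (ha : a ∈ A) : G a ≤ supp G A :=
  le_csSup (A.isCompact.image hG).bddAbove (mem_image_of_mem _ ha)

theorem supp_le_iff (hG : Continuous G) {A : Mpc κ} {c : ℝ} : supp G A ≤ c ↔ ∀ a ∈ A, G a ≤ c := by
  refine ⟨fun h a ha => (le_supp hG ha).trans h, fun h => ?_⟩
  obtain ⟨a, ha, e⟩ := exists_mem_eq_supp hG A
  exact e ▸ h a ha

theorem supp_lt_iff (hG : Continuous G) {A : Mpc κ} {c : ℝ} : supp G A < c ↔ ∀ a ∈ A, G a < c := by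
  refine ⟨fun h a ha => (le_supp hG ha).trans_lt h, fun h => ?_⟩
  obtain ⟨a, ha, e⟩ := exists_mem_eq_supp hG A
  exact e ▸ h a ha

theorem lt_supp_iff (hG : Continuous G) {A : Mpc κ} {c : ℝ} : c < supp G A ↔ ∃ a ∈ A, c < G a := by
  simpa using (supp_le_iff hG (A := A) (c := c)).not

theorem continuous_supp (hG : Continuous G) : Continuous (supp G) := by
  refine OrderTopology.continuous_iff.2 fun c => ⟨?_, ?_⟩
  · convert isOpen_inter_nonempty (hG.isOpen_preimage _ (isOpen_Ioi (a := c))) using 1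
    ext A
    exact lt_supp_iff hG
  · convert isOpen_subset (hG.isOpen_preimage _ (isOpen_Iio (a := c))) using 1
    ext A
    exact supp_lt_iff hG

end supp

/-- The excess `max (0, max_{j ∈ F} (x j - y j))`. -/
noncomputable def gap (F : Finset κ) (y : F → ℝ) (x : κ → ℝ) : ℝ :=
  Finset.univ.sup' Finset.univ_nonempty (fun o : Option F => o.elim 0 fun j => x j - y j)

theorem gap_le_iff {F : Finset κ} {y : F → ℝ} {x : κ → ℝ} {c : ℝ} :
    gap F y x ≤ c ↔ 0 ≤ c ∧ ∀ j : F, x j - y j ≤ c := by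
  rw [gap, Finset.sup'_le_iff]
  simp [Option.forall]

theorem gap_nonneg (F : Finset κ) (y : F → ℝ) (x : κ → ℝ) : 0 ≤ gap F y x :=
  (gap_le_iff.1 le_rfl).1

theorem sub_le_gap {F : Finset κ} (y : F → ℝ) (x : κ → ℝ) (j : F) : x j - y j ≤ gap F y x :=
  (gap_le_iff.1 le_rfl).2 j

theorem continuous_gap (F : Finset κ) (y : F → ℝ) : Continuous (gap F y) := by
  refine Continuous.finset_sup'_apply _ fun o _ => ?_
  cases o
  · exact continuous_const
  · simp only [Option.elim_some]
    fun_prop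

/-- The functions testing whether a max-plus convex set has a point near `y`. -/
noncomputable def test (F : Finset κ) (y : F → ℝ) (o : Option F) (x : κ → ℝ) : ℝ :=
  (o.elim 0 fun i => x i - y i) - gap F y x

theorem quasiConvex_test (F : Finset κ) (y : F → ℝ) (o : Option F) : QuasiConvex (test F y o) where
  continuous := by
    have := continuous_gap F y
    unfold test
    cases o
    · simp only [Option.elim_none]
      fun_prop
    · simp only [Option.elim_some]
      fun_prop
  le_max a b t ht := by
    have h₁ : gap F y a ≤ gap F y (fun i => max (a i) (t + b i)) :=
      gap_le_iff.2 ⟨gap_nonneg _ _ _, fun j => le_trans (by simp)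
        (sub_le_gap y (fun i => max (a i) (t + b i)) j)⟩
    have h₂ : gap F y b ≤ gap F y (fun i => max (a i) (t + b i)) - t :=
      gap_le_iff.2 ⟨by linarith [gap_nonneg F y (fun i => max (a i) (t + b i))], fun j => by
        have := sub_le_gap y (fun i => max (a i) (t + b i)) j
        have := le_max_right (a j) (t + b j)
        linarith⟩
    cases o with
    | none => simp only [test, Option.elim_none]; exact le_max_of_le_left (by linarith)
    | some i =>
      simp only [test, Option.elim_some]
      rcases max_choice (a i) (t + b i) with h | h <;> rw [h]
      · exact le_max_of_le_left (by linarith)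
      · exact le_max_of_le_right (by linarith)

theorem quasiConvex_apply (i : κ) : QuasiConvex (fun x : κ → ℝ => x i) where
  continuous := continuous_apply i
  le_max a b t ht := max_le_max le_rfl (by linarith)

theorem quasiConvex_neg_apply (i : κ) : QuasiConvex (fun x : κ → ℝ => - x i) where
  continuous := (continuous_apply i).neg
  le_max a b t ht := le_max_of_le_left (by simp)

theorem lt_test_of_close {F : Finset κ} {y : F → ℝ} {x : κ → ℝ} {δ : ℝ} (hδ : 0 < δ)
    (h : ∀ i : F, |x i - y i| < δ) (o : Option F) : -(2 * δ) < test F y o x := by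
  have hg : gap F y x ≤ δ := gap_le_iff.2 ⟨hδ.le, fun j => (abs_lt.1 (h j)).2.le⟩
  cases o with
  | none => simp only [test, Option.elim_none]; linarith
  | some i =>
    have := (abs_lt.1 (h i)).1
    simp only [test, Option.elim_some]
    linarith

theorem exists_mem_close_of_lt_supp {A : Mpc κ} {F : Finset κ} {y : F → ℝ} {δ : ℝ}
    (h : ∀ o, -δ < supp (test F y o) A) : ∃ a ∈ A, ∀ i : F, |a i - y i| < δ := by
  classical
  have h' := fun o => (lt_supp_iff (quasiConvex_test F y o).continuous).1 (h o)
  have key : ∀ s : Finset F, ∃ a ∈ A, (∀ j : F, a j < y j + δ) ∧ ∀ i ∈ s, y i - δ < a i := by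
    intro s
    induction s using Finset.induction_on with
    | empty =>
      obtain ⟨a, ha, hlt⟩ := h' none
      simp only [test, Option.elim_none] at hlt
      exact ⟨a, ha, fun j => by linarith [sub_le_gap y a j], by simp⟩
    | insert i s _ ih =>
      obtain ⟨a, ha, hup, hlo⟩ := ih
      obtain ⟨b, hb, hlt⟩ := h' (some i)
      simp only [test, Option.elim_some] at hlt
      have hδ : 0 < δ := by linarith [sub_le_gap y b i]
      refine ⟨_, A.max_mem ha hb (neg_nonpos.2 (gap_nonneg F y b)), fun j => ?_, fun j hj => ?_⟩
      · exact max_lt (hup j) (by linarith [sub_le_gap y b j])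
      · rcases Finset.mem_insert.1 hj with rfl | hj
        · exact lt_max_of_lt_right (by linarith)
        · exact lt_max_of_lt_left (hlo j hj)
  obtain ⟨a, ha, hup, hlo⟩ := key Finset.univ
  exact ⟨a, ha, fun i => abs_lt.2 ⟨by linarith [hlo i (Finset.mem_univ i)], by linarith [hup i]⟩⟩

/-- Index set of a separating family of test functions. -/
abbrev TestIndex (κ : Type*) : Type _ := (Σ F : Finset κ, (F → ℚ) × Option F) ⊕ κ ⊕ κ

/-- A separating family of quasiconvex functions, countable if `κ` is. -/
noncomputable def testFamily : TestIndex κ → (κ → ℝ) → ℝ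
  | .inl ⟨F, y, o⟩ => test F (fun i => (y i : ℝ)) o
  | .inr (.inl i) => fun x => x i
  | .inr (.inr i) => fun x => - x i

theorem quasiConvex_testFamily : ∀ j : TestIndex κ, QuasiConvex (testFamily j)
  | .inl ⟨_, _, _⟩ => quasiConvex_test _ _ _
  | .inr (.inl _) => quasiConvex_apply _
  | .inr (.inr _) => quasiConvex_neg_apply _

theorem exists_finite_rat_net (ι : Type*) [Fintype ι] (c : ℝ) {δ : ℝ} (hδ : 0 < δ) :
    ∃ T : Finset (ι → ℚ), ∀ x : ι → ℝ, (∀ i, |x i| ≤ c) → ∃ y ∈ T, ∀ i, |x i - y i| < δ := by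
  have hK : IsCompact (Set.univ.pi fun _ : ι => Icc (-c) c) :=
    isCompact_univ_pi fun _ => isCompact_Icc
  obtain ⟨T, hT⟩ := hK.elim_finite_subcover
    (fun y : ι → ℚ => {x : ι → ℝ | ∀ i, |x i - y i| < δ})
    (fun y => by
      simp only [ofPred_forall]
      exact isOpen_iInter_of_finite fun i => isOpen_lt (by fun_prop) continuous_const)
    (fun x _ => by
      choose y hy using fun i => exists_rat_near (x i) hδ
      exact mem_iUnion.2 ⟨y, hy⟩)
  refine ⟨T, fun x hx => ?_⟩
  obtain ⟨y, hy, h⟩ := mem_iUnion₂.1 (hT (fun i _ => abs_le.1 (hx i)))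
  exact ⟨y, hy, h⟩

theorem le_nhds_of_tendsto_supp {A : Mpc κ} {l : Filter (Mpc κ)}
    (h : ∀ j, Tendsto (supp (testFamily j)) l (𝓝 (supp (testFamily j) A))) : l ≤ 𝓝 A := by
  rw [A.hasBasis_nhds.ge_iff]
  rintro ⟨F, ε⟩ hε
  simp only at hε
  set δ := ε / 4 with hδe
  have hδ : 0 < δ := by positivity
  obtain ⟨c, hc⟩ : ∃ c, ∀ i ∈ F, supp (fun x => x i) A < c ∧ supp (fun x => - x i) A < c := by
    refine ⟨∑ i ∈ F, (|supp (fun x => x i) A| + |supp (fun x => - x i) A|) + 1, fun i hi => ?_⟩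
    have := Finset.single_le_sum
      (f := fun i => |supp (fun x => x i) A| + |supp (fun x => - x i) A|)
      (fun i _ => by positivity) hi
    have h₁ := le_abs_self (supp (fun x => x i) A)
    have h₂ := le_abs_self (supp (fun x => - x i) A)
    have h₃ := abs_nonneg (supp (fun x => x i) A)
    have h₄ := abs_nonneg (supp (fun x => - x i) A)
    constructor <;> linarith
  obtain ⟨T, hT⟩ := exists_finite_rat_net F c hδ
  have bound : ∀ B : Mpc κ, (∀ i ∈ F, supp (fun x => x i) B < c ∧ supp (fun x => - x i) B < c) →
      ∀ b ∈ B, ∃ y ∈ T, ∀ i : F, |b i - y i| < δ := by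
    intro B hB b hb
    refine hT (fun i => b i) fun i => abs_le.2 ?_
    have h₁ := le_supp (quasiConvex_apply (i : κ)).continuous hb
    have h₂ := le_supp (quasiConvex_neg_apply (i : κ)).continuous hb
    have h₃ := hB i i.2
    constructor <;> linarith
  have ev₁ : ∀ᶠ B in l, ∀ i ∈ F, supp (fun x => x i) B < c ∧ supp (fun x => - x i) B < c :=
    (eventually_all_finset F).2 fun i hi =>
      ((h (.inr (.inl i))).eventually (gt_mem_nhds (hc i hi).1)).and
        ((h (.inr (.inr i))).eventually (gt_mem_nhds (hc i hi).2))
  have ev₂ : ∀ᶠ B in l, ∀ y ∈ T, ∀ o : Option F,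
      (-(2 * δ) < supp (test F (fun i => (y i : ℝ)) o) A →
        -(2 * δ) < supp (test F (fun i => (y i : ℝ)) o) B) ∧
      (supp (test F (fun i => (y i : ℝ)) o) A ≤ -(3 * δ) →
        supp (test F (fun i => (y i : ℝ)) o) B < -(2 * δ)) := by
    refine (eventually_all_finset T).2 fun y _ => eventually_all.2 fun o => ?_
    have ht := h (.inl ⟨F, y, o⟩)
    refine Eventually.and ?_ ?_
    · by_cases hlt : -(2 * δ) < supp (test F (fun i => (y i : ℝ)) o) A
      · filter_upwards [ht.eventually (lt_mem_nhds hlt)] with B hB _ using hB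
      · exact Eventually.of_forall fun _ h' => absurd h' hlt
    · by_cases hlt : supp (test F (fun i => (y i : ℝ)) o) A ≤ -(3 * δ)
      · filter_upwards [ht.eventually (gt_mem_nhds (hlt.trans_lt (b := -(3 * δ))
          (c := -(2 * δ)) (by linarith)))] with B hB _ using hB
      · exact Eventually.of_forall fun _ h' => absurd h' hlt
  filter_upwards [ev₁, ev₂] with B h₁ h₂
  refine ⟨fun a ha => ?_, fun b hb => ?_⟩
  · obtain ⟨y, hy, hay⟩ := bound A hc a ha
    obtain ⟨b, hb, hby⟩ := exists_mem_close_of_lt_supp (A := B) fun o => (h₂ y hy o).1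
      ((lt_test_of_close hδ hay o).trans_le (le_supp (quasiConvex_test _ _ _).continuous ha))
    refine ⟨b, hb, fun i hi => ?_⟩
    have h₃ := abs_lt.1 (hay ⟨i, hi⟩)
    have h₄ := abs_lt.1 (hby ⟨i, hi⟩)
    simp only at h₃ h₄
    exact abs_lt.2 ⟨by linarith, by linarith⟩
  · obtain ⟨y, hy, hby⟩ := bound B h₁ b hb
    obtain ⟨a, ha, hay⟩ := exists_mem_close_of_lt_supp (A := A) (F := F)
        (y := fun i => (y i : ℝ)) (δ := 3 * δ) fun o => by
      by_contra! hle
      have := (h₂ y hy o).2 hle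
      linarith [(lt_test_of_close hδ hby o).trans_le
        (le_supp (quasiConvex_test _ _ _).continuous hb)]
    refine ⟨a, ha, fun i hi => ?_⟩
    have h₃ := abs_lt.1 (hay ⟨i, hi⟩)
    have h₄ := abs_lt.1 (hby ⟨i, hi⟩)
    simp only at h₃ h₄
    exact abs_lt.2 ⟨by linarith, by linarith⟩

theorem isEmbedding_supp {f : ℕ → TestIndex κ} (hf : Function.Surjective f) :
    IsEmbedding fun (A : Mpc κ) n => supp (testFamily (f n)) A := by
  have hcont : Continuous fun (A : Mpc κ) n => supp (testFamily (f n)) A :=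
    continuous_pi fun n => continuous_supp (quasiConvex_testFamily _).continuous
  refine IsInducing.isEmbedding (isInducing_iff_nhds.2 fun A =>
    le_antisymm (hcont.tendsto A).le_comap (le_nhds_of_tendsto_supp fun j => ?_))
  obtain ⟨n, rfl⟩ := hf j
  exact ((continuous_apply (A := fun _ : ℕ => ℝ) n).tendsto _).comp tendsto_comap

instance [Countable κ] : MetrizableSpace (Mpc κ) := by
  obtain ⟨f, hf⟩ := exists_surjective_nat (TestIndex κ)
  exact (isEmbedding_supp hf).metrizableSpace

end Mpc

theorem MaxPlusConvex.exists_mul_exp_eq_max {κ : Type*} {S : Set (κ → ℝ)} (hS : MaxPlusConvex S)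
    {a b : κ → ℝ} (ha : a ∈ S) (hb : b ∈ S) {p q : ℝ} (hp : 0 ≤ p) (hq : 0 ≤ q) :
    ∃ c ∈ S, ∀ i, max (p * Real.exp (a i)) (q * Real.exp (b i)) = max p q * Real.exp (c i) := by
  wlog hqp : q ≤ p generalizing a b p q
  · obtain ⟨c, hc, h⟩ := this hb ha hq hp (not_le.1 hqp).le
    exact ⟨c, hc, fun i => by rw [max_comm, h i, max_comm]⟩
  rw [max_eq_left hqp]
  rcases hq.eq_or_lt with rfl | hq
  · exact ⟨a, ha, fun i => by rw [zero_mul, max_eq_left (by positivity)]⟩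
  · have hp' : 0 < p := hq.trans_le hqp
    refine ⟨_, hS a ha b hb (Real.log (q / p))
      (Real.log_nonpos (by positivity) ((div_le_one hp').2 hqp)), fun i => ?_⟩
    rw [Real.exp_monotone.map_max, Real.exp_add, Real.exp_log (by positivity),
      mul_max_of_nonneg _ _ hp]
    congr 1
    field_simp

namespace Mpc

variable {κ κ' : Type*}

/-- Max-plus combination of two points with coefficients written multiplicatively. -/
noncomputable def mix (σ τ : ℝ) (a b : κ → ℝ) (i : κ) : ℝ :=
  Real.log (max (σ * Real.exp (a i)) (τ * Real.exp (b i)))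

theorem exp_mix {σ τ : ℝ} (h : max σ τ = 1) (a b : κ → ℝ) (i : κ) :
    Real.exp (mix σ τ a b i) = max (σ * Real.exp (a i)) (τ * Real.exp (b i)) := by
  refine Real.exp_log ?_
  rcases max_choice σ τ with h' | h' <;> rw [h] at h' <;> rw [← h']
  · exact lt_max_of_lt_left (by positivity)
  · exact lt_max_of_lt_right (by positivity)

theorem mix_mem {S : Set (κ → ℝ)} (hS : MaxPlusConvex S) {a b : κ → ℝ} (ha : a ∈ S) (hb : b ∈ S)
    {σ τ : ℝ} (hσ : 0 ≤ σ) (hτ : 0 ≤ τ) (h : max σ τ = 1) : mix σ τ a b ∈ S := by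
  obtain ⟨c, hc, hcm⟩ := hS.exists_mul_exp_eq_max ha hb hσ hτ
  convert hc using 1
  funext i
  rw [mix, hcm, h, one_mul, Real.log_exp]

theorem max_min_eq_one (θ : ℝ) : max (min 1 (2 - θ)) (min 1 θ) = 1 := by
  rcases le_total 1 θ with h | h
  · rw [min_eq_left h, max_eq_right (min_le_left _ _)]
  · rw [min_eq_left (by linarith : (1 : ℝ) ≤ 2 - θ), max_eq_left (min_le_left _ _)]

/-- The path from `a` to `b` inside the max-plus segment. -/
noncomputable def path (p : (κ → ℝ) × (κ → ℝ) × ℝ) : κ → ℝ :=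
  mix (min 1 (2 - p.2.2)) (min 1 p.2.2) p.1 p.2.1

theorem continuous_path : Continuous (path (κ := κ)) := by
  refine continuous_pi fun i => Continuous.log (by fun_prop) fun p => ?_
  rw [← exp_mix (max_min_eq_one _)]
  exact (Real.exp_pos _).ne'

theorem path_zero (a b : κ → ℝ) : path (a, b, 0) = a := by
  funext i
  simp [path, mix, Real.exp_nonneg]

theorem path_two (a b : κ → ℝ) : path (a, b, 2) = b := by
  funext i
  simp [path, mix, Real.exp_nonneg]

/-- The max-plus convex hull of the union of two sets. -/
noncomputable def join (A B : Mpc κ) : Mpc κ :=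
  ⟨path '' ((A : Set (κ → ℝ)) ×ˢ (B : Set (κ → ℝ)) ×ˢ Icc 0 2),
    (A.nonempty.prod (B.nonempty.prod (nonempty_Icc.2 zero_le_two))).image _,
    (A.isCompact.prod (B.isCompact.prod isCompact_Icc)).image continuous_path, by
      rintro _ ⟨⟨a, b, θ⟩, ⟨ha, hb, hθ⟩, rfl⟩ _ ⟨⟨a', b', θ'⟩, ⟨ha', hb', hθ'⟩, rfl⟩ t ht
      simp only at ha hb hθ ha' hb' hθ'
      have hr : 0 ≤ Real.exp t := Real.exp_nonneg t
      have hr1 : Real.exp t ≤ 1 := Real.exp_le_one_iff.2 ht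
      have nn : ∀ θ ∈ Icc (0 : ℝ) 2, 0 ≤ min 1 (2 - θ) ∧ 0 ≤ min 1 θ := fun θ h =>
        ⟨le_min zero_le_one (by linarith [h.2]), le_min zero_le_one h.1⟩
      obtain ⟨c, hc, hcm⟩ := A.2.2.2.exists_mul_exp_eq_max ha ha' (nn θ hθ).1
        (mul_nonneg hr (nn θ' hθ').1)
      obtain ⟨d, hd, hdm⟩ := B.2.2.2.exists_mul_exp_eq_max hb hb' (nn θ hθ).2
        (mul_nonneg hr (nn θ' hθ').2)
      set σ := max (min 1 (2 - θ)) (Real.exp t * min 1 (2 - θ')) with hσ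
      set τ := max (min 1 θ) (Real.exp t * min 1 θ') with hτ
      have hσ0 : 0 ≤ σ := le_max_of_le_left (nn θ hθ).1
      have hτ0 : 0 ≤ τ := le_max_of_le_left (nn θ hθ).2
      have hmax : max σ τ = 1 := by
        rw [hσ, hτ, max_max_max_comm, max_min_eq_one, ← mul_max_of_nonneg _ _ hr, max_min_eq_one,
          mul_one, max_eq_left hr1]
      have key : ∀ i, max (path (a, b, θ) i) (t + path (a', b', θ') i) = mix σ τ c d i := by
        intro i
        apply Real.exp_injective
        rw [Real.exp_monotone.map_max, Real.exp_add, exp_mix hmax, ← hcm, ← hdm, path, path,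
          exp_mix (max_min_eq_one _), exp_mix (max_min_eq_one _), mul_max_of_nonneg _ _ hr,
          max_max_max_comm]
        simp only [mul_assoc]
      rcases max_choice σ τ with h | h <;> rw [hmax] at h
      · have hτ1 : τ ≤ 1 := hmax ▸ le_max_right _ _
        refine ⟨(c, d, τ), ⟨hc, hd, hτ0, by linarith⟩, funext fun i => ?_⟩
        rw [key, path, ← h, min_eq_left (by linarith : (1 : ℝ) ≤ 2 - τ), min_eq_right hτ1]
      · have hσ1 : σ ≤ 1 := hmax ▸ le_max_left _ _
        refine ⟨(c, d, 2 - σ), ⟨hc, hd, by simp only; linarith, by simp only; linarith⟩,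
          funext fun i => ?_⟩
        rw [key, path, ← h, min_eq_left (by linarith : (1 : ℝ) ≤ 2 - σ), sub_sub_cancel,
          min_eq_right hσ1]⟩

theorem path_mem_join {A B : Mpc κ} {a b : κ → ℝ} (ha : a ∈ A) (hb : b ∈ B) {θ : ℝ}
    (hθ : θ ∈ Icc (0 : ℝ) 2) : path (a, b, θ) ∈ join A B :=
  ⟨_, ⟨ha, hb, hθ⟩, rfl⟩

theorem path_mem {S : Set (κ → ℝ)} (hS : MaxPlusConvex S) {a b : κ → ℝ} (ha : a ∈ S) (hb : b ∈ S)
    {θ : ℝ} (hθ : θ ∈ Icc (0 : ℝ) 2) : path (a, b, θ) ∈ S :=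
  mix_mem hS ha hb (le_min zero_le_one (by simp only; linarith [hθ.2]))
    (le_min zero_le_one hθ.1) (max_min_eq_one _)

theorem join_subset {A B : Mpc κ} {S : Set (κ → ℝ)} (hS : MaxPlusConvex S)
    (hA : ∀ a ∈ A, a ∈ S) (hB : ∀ b ∈ B, b ∈ S) : ∀ x ∈ join A B, x ∈ S := by
  rintro _ ⟨⟨a, b, θ⟩, ⟨ha, hb, hθ⟩, rfl⟩
  exact path_mem hS (hA a ha) (hB b hb) hθ

theorem subset_join_left (A B : Mpc κ) : ∀ a ∈ A, a ∈ join A B := fun a ha => by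
  obtain ⟨b, hb⟩ := B.nonempty
  rw [← path_zero a b]
  exact path_mem_join ha hb ⟨le_rfl, zero_le_two⟩

theorem QuasiConvex.maxPlusConvex_sublevel {G : (κ → ℝ) → ℝ} (hG : QuasiConvex G) (c : ℝ) :
    MaxPlusConvex {x | G x ≤ c} :=
  fun a ha b hb t ht => (hG.le_max a b t ht).trans (max_le ha hb)

theorem supp_join_le {G : (κ → ℝ) → ℝ} (hG : QuasiConvex G) (A B : Mpc κ) :
    supp G (join A B) ≤ max (supp G A) (supp G B) :=
  (supp_le_iff hG.continuous).2 <| join_subset (hG.maxPlusConvex_sublevel _)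
    (fun _ ha => le_max_of_le_left (le_supp hG.continuous ha))
    (fun _ hb => le_max_of_le_right (le_supp hG.continuous hb))

theorem supp_mono {G : (κ → ℝ) → ℝ} (hG : Continuous G) {A B : Mpc κ} (h : ∀ a ∈ A, a ∈ B) :
    supp G A ≤ supp G B :=
  (supp_le_iff hG).2 fun a ha => le_supp hG (h a ha)

/-- Each fibre of `res e` is connected in a strong sense. -/
theorem exists_res_eq_supp_eq (e : κ → κ') {A B : Mpc κ'} (hAB : res e A = res e B)
    {G : (κ' → ℝ) → ℝ} (hG : QuasiConvex G) {s : ℝ} (hA : supp G A ≤ s) (hB : s ≤ supp G B) :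
    ∃ C : Mpc κ', res e C = res e A ∧ supp G C = s ∧
      ∀ G', QuasiConvex G' → supp G' C ∈ uIcc (supp G' A) (supp G' B) := by
  have hAs : ∀ a ∈ A, G a ≤ s := (supp_le_iff hG.continuous).1 hA
  let C : Mpc κ' := ⟨(join A B : Set (κ' → ℝ)) ∩ {x | G x ≤ s},
    A.nonempty.mono fun a ha => ⟨subset_join_left A B a ha, hAs a ha⟩,
    (join A B).isCompact.inter_right (isClosed_le hG.continuous continuous_const),
    fun a ha b hb t ht => ⟨(join A B).max_mem ha.1 hb.1 ht,
      hG.maxPlusConvex_sublevel s a ha.2 b hb.2 t ht⟩⟩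
  have hAC : ∀ a ∈ A, a ∈ C := fun a ha => ⟨subset_join_left A B a ha, hAs a ha⟩
  have hCj : ∀ c ∈ C, c ∈ join A B := fun c hc => hc.1
  refine ⟨C, ?_, le_antisymm ((supp_le_iff hG.continuous).2 fun c hc => hc.2) ?_, ?_⟩
  · have hconv : MaxPlusConvex {x : κ' → ℝ | x ∘ e ∈ res e A} :=
      fun a ha b hb t ht => (res e A).max_mem ha hb ht
    apply SetLike.coe_injective
    refine Subset.antisymm ?_ (image_mono hAC)
    rintro _ ⟨c, hc, rfl⟩
    exact join_subset hconv (fun a ha => comp_mem_res e ha)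
      (fun b hb => hAB ▸ comp_mem_res e hb) c (hCj c hc)
  · obtain ⟨a, ha⟩ := A.nonempty
    obtain ⟨b, hb, hbs⟩ := exists_mem_eq_supp hG.continuous B
    have hc : Continuous fun θ : ℝ => G (path (a, b, θ)) :=
      hG.continuous.comp (continuous_path.comp (by fun_prop))
    obtain ⟨θ, hθ, hs⟩ := intermediate_value_Icc zero_le_two hc.continuousOn
      (show s ∈ Icc _ _ from ⟨by simpa only [path_zero] using hAs a ha,
        by simpa only [path_two, hbs] using hB⟩)
    simp only at hs
    exact hs ▸ le_supp hG.continuous (show path (a, b, θ) ∈ C from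
      ⟨path_mem_join ha hb hθ, hs.le⟩)
  · intro G' hG'
    have h₁ := supp_mono hG'.continuous hAC
    have h₂ := (supp_mono hG'.continuous hCj).trans (supp_join_le hG' A B)
    exact ⟨(min_le_left _ _).trans h₁, h₂⟩

/-- Limits in the fibres of `res e` exist. -/
theorem exists_res_eq_supp_eq_of_tendsto (e : κ → κ') {B : Mpc κ} {A : ℕ → Mpc κ'}
    (hA : ∀ n, res e (A n) = B) {x : TestIndex κ' → ℝ}
    (hx : ∀ j, Tendsto (fun n => supp (testFamily j) (A n)) atTop (𝓝 (x j))) :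
    ∃ C : Mpc κ', res e C = B ∧ ∀ j, supp (testFamily j) C = x j := by
  have hb : ∀ j, ∃ c, ∀ n, supp (testFamily j) (A n) ≤ c := fun j => by
    obtain ⟨c, hc⟩ := (hx j).bddAbove_range
    exact ⟨c, fun n => hc ⟨n, rfl⟩⟩
  choose c hc using hb
  have hK : IsCompact (Set.univ.pi fun i : κ' => Icc (-c (.inr (.inr i))) (c (.inr (.inl i)))) :=
    isCompact_univ_pi fun _ => isCompact_Icc
  have hsub : ∀ n, A n ∈ {A : Mpc κ' | (A : Set (κ' → ℝ)) ⊆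
      Set.univ.pi fun i : κ' => Icc (-c (.inr (.inr i))) (c (.inr (.inl i)))} := by
    intro n a ha i _
    have h₁ := (le_supp (quasiConvex_apply i).continuous ha).trans (hc (.inr (.inl i)) n)
    have h₂ := (le_supp (quasiConvex_neg_apply i).continuous ha).trans (hc (.inr (.inr i)) n)
    exact ⟨by linarith, h₁⟩
  obtain ⟨C, -, hC⟩ := (isCompact_setOf_subset hK).ultrafilter_le_nhds
    ((Ultrafilter.of atTop).map A) (le_principal_iff.2 (mem_map.2 (univ_mem' hsub)))
  have hC' : Tendsto A (Ultrafilter.of (atTop : Filter ℕ)) (𝓝 C) := hC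
  refine ⟨C, ?_, fun j => ?_⟩
  · refine tendsto_nhds_unique (((continuous_res e).tendsto C).comp hC') ?_
    simp only [Function.comp_def, hA]
    exact tendsto_const_nhds
  · exact tendsto_nhds_unique
      (((continuous_supp (quasiConvex_testFamily j).continuous).tendsto C).comp hC')
      ((hx j).mono_left (Ultrafilter.of_le _))

/-- Adding coordinates does not change the hyperspace up to a factor `ℕ → ℝ`. -/
theorem exists_homeomorph_over_res [Countable κ] [Countable κ'] {e : κ → κ'}
    (he : Function.Injective e) :
    ∃ h : Mpc κ' × (ℕ → ℝ) ≃ₜ Mpc κ × (ℕ → ℝ), ∀ x, (h x).1 = res e x.1 := by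
  obtain ⟨f, hf⟩ := exists_surjective_nat (TestIndex κ')
  refine exists_homeomorph_prod_of_coordinates (continuous_res e) (isOpenMap_res he)
    (surjective_res he) (fun A n => supp (testFamily (f n)) A) (isEmbedding_supp hf) ?_ ?_
  · intro A B j s hAB hA hB
    obtain ⟨C, h₁, h₂, h₃⟩ := exists_res_eq_supp_eq e hAB (quasiConvex_testFamily (f j)) hA hB
    exact ⟨C, h₁, h₂, fun k => h₃ _ (quasiConvex_testFamily (f k))⟩
  · intro B A x hA hx
    obtain ⟨g, hg⟩ := hf.hasRightInverse
    obtain ⟨C, h₁, h₂⟩ := exists_res_eq_supp_eq_of_tendsto e hA (x := fun j => x (g j))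
      (fun j => by simpa only [hg j] using hx (g j))
    refine ⟨C, h₁, funext fun n => ?_⟩
    rw [h₂]
    refine tendsto_nhds_unique (hx _) ?_
    simp only [hg (f n)]
    exact hx n

instance {κ : Type*} : Nonempty (Mpc κ) :=
  ⟨⟨{0}, singleton_nonempty 0, isCompact_singleton, by
    rintro _ rfl _ rfl t ht
    exact funext fun i => by simpa using ht⟩⟩

section Glue

variable {I : Type*} [LinearOrder I] {X : I → Type*} {κ : Type*} {e : ∀ i, X i → κ}
  {t : ∀ i j, i ≤ j → X i → X j}

theorem exists_finset_subset_range (ht : ∀ i j h x, e j (t i j h x) = e i x)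
    (hcov : ∀ k, ∃ i x, e i x = k) {F : Finset κ} (hF : F.Nonempty) :
    ∃ i, ∀ k ∈ F, ∃ x, e i x = k := by
  choose g hg using hcov
  obtain ⟨k₀, hk₀, hmax⟩ := F.exists_max_image g hF
  refine ⟨g k₀, fun k hk => ?_⟩
  obtain ⟨x, hx⟩ := hg k
  exact ⟨t _ _ (hmax k hk) x, by rw [ht, hx]⟩

/-- The topology of the hyperspace is determined by an exhausting family of restrictions. -/
theorem tendsto_of_res (ht : ∀ i j h x, e j (t i j h x) = e i x)
    (hcov : ∀ k, ∃ i x, e i x = k) {Y : Type*} {l : Filter Y} {g : Y → Mpc κ} {A : Mpc κ}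
    (h : ∀ i, Tendsto (fun y => res (e i) (g y)) l (𝓝 (res (e i) A))) : Tendsto g l (𝓝 A) := by
  classical
  rw [A.hasBasis_nhds.tendsto_right_iff]
  rintro ⟨F, ε⟩ hε
  rcases F.eq_empty_or_nonempty with rfl | hF
  · refine Eventually.of_forall fun y => ⟨fun a _ => ?_, fun b _ => ?_⟩
    · exact (g y).nonempty.imp fun b hb => ⟨hb, by simp⟩
    · exact A.nonempty.imp fun b hb => ⟨hb, by simp⟩
  · obtain ⟨i, hi⟩ := exists_finset_subset_range ht hcov hF
    have : Nonempty (X i) := hF.elim fun k hk => ⟨(hi k hk).choose⟩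
    choose! x hx using hi
    filter_upwards [(h i).eventually
      (mem_nhds_iff.2 ⟨F.image x, ε, hε, fun B hB => hB⟩)] with y hy
    refine ⟨fun a ha => ?_, fun b hb => ?_⟩
    · obtain ⟨_, ⟨b, hb, rfl⟩, hab⟩ := hy.1 _ (comp_mem_res (e i) ha)
      refine ⟨b, hb, fun k hk => ?_⟩
      simpa [hx k hk] using hab (x k) (Finset.mem_image_of_mem x hk)
    · obtain ⟨_, ⟨a, ha, rfl⟩, hab⟩ := hy.2 _ (comp_mem_res (e i) hb)
      refine ⟨a, ha, fun k hk => ?_⟩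
      simpa [hx k hk] using hab (x k) (Finset.mem_image_of_mem x hk)

theorem eq_of_res_eq (ht : ∀ i j h x, e j (t i j h x) = e i x)
    (hcov : ∀ k, ∃ i x, e i x = k) {A B : Mpc κ} (h : ∀ i, res (e i) A = res (e i) B) : A = B :=
  tendsto_nhds_unique (tendsto_const_nhds (f := (atTop : Filter ℕ)))
    (tendsto_of_res ht hcov fun i => by simpa only [h i] using tendsto_const_nhds)

/-- Coherent families glue. -/
theorem exists_res_eq_of_coherent (he : ∀ i, Function.Injective (e i))
    (ht : ∀ i j h x, e j (t i j h x) = e i x) (hcov : ∀ k, ∃ i x, e i x = k)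
    (f : ∀ i, Mpc (X i)) (hf : ∀ i j h, res (t i j h) (f j) = f i) :
    ∃ A : Mpc κ, ∀ i, res (e i) A = f i := by
  classical
  have hte : ∀ i j h (x : κ → ℝ), (x ∘ e j) ∘ t i j h = x ∘ e i := fun i j h x =>
    funext fun k => congrArg x (ht i j h k)
  choose g q hq using hcov
  let P : κ → Set ℝ := fun k => (fun b : X (g k) → ℝ => b (q k)) '' (f (g k) : Set _)
  have hPc : ∀ k, IsCompact (P k) := fun k => (f (g k)).isCompact.image (continuous_apply _)
  have hPn : ∀ k, (P k).Nonempty := fun k => (f (g k)).nonempty.image _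
  have hP : ∀ j, ∀ b ∈ f j, ∀ y, b y ∈ P (e j y) := by
    intro j b hb y
    rcases le_total (g (e j y)) j with h | h
    · have hy : t _ _ h (q (e j y)) = y := he j (by rw [ht, hq])
      refine ⟨b ∘ t _ _ h, ?_, congrArg b hy⟩
      rw [← hf _ _ h]
      exact comp_mem_res _ hb
    · have hy : t _ _ h y = q (e j y) := he _ (by rw [ht, hq])
      rw [← hf _ _ h] at hb
      obtain ⟨c, hc, rfl⟩ := hb
      exact ⟨c, hc, congrArg c hy.symm⟩
  have hbox : IsCompact (Set.univ.pi P) := isCompact_univ_pi hPc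
  have hcl : ∀ i, IsClosed {x : κ → ℝ | x ∘ e i ∈ f i} := fun i =>
    (f i).isCompact.isClosed.preimage (by fun_prop)
  have hmono : ∀ i j, i ≤ j → ∀ x : κ → ℝ, x ∘ e j ∈ f j → x ∘ e i ∈ f i := by
    intro i j h x hx
    rw [← hf i j h, ← hte i j h]
    exact comp_mem_res _ hx
  let S : Set (κ → ℝ) := {x | ∀ i, x ∘ e i ∈ f i}
  have hSsub : S ⊆ Set.univ.pi P := fun x hx k _ => by
    have := hP _ _ (hx (g k)) (q k)
    simpa only [Function.comp_apply, hq] using this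
  have hSc : IsCompact S := hbox.of_isClosed_subset (by
    simp only [S, ofPred_forall]
    exact isClosed_iInter hcl) hSsub
  have key : ∀ i, ∀ a ∈ f i, ∃ x ∈ S, x ∘ e i = a := by
    intro i a ha
    let C : Ici i → Set (κ → ℝ) := fun j =>
      Set.univ.pi P ∩ ({x | x ∘ e j ∈ f j} ∩ {x | x ∘ e i = a})
    have hCcl : ∀ j, IsClosed ({x : κ → ℝ | x ∘ e j ∈ f j} ∩ {x | x ∘ e i = a}) :=
      fun j => (hcl j).inter (isClosed_singleton.preimage
        (f := fun x : κ → ℝ => x ∘ e i) (by fun_prop))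
    have : Nonempty (Ici i) := ⟨⟨i, le_rfl⟩⟩
    obtain ⟨x, hx⟩ := IsCompact.nonempty_iInter_of_directed_nonempty_isCompact_isClosed C
      (directed_of_isDirected_le fun j k hjk x hx => ⟨hx.1, hmono _ _ hjk x hx.2.1, hx.2.2⟩)
      (fun j => by
        have ha' := ha
        rw [← hf i j j.2] at ha'
        obtain ⟨b, hb, rfl⟩ := ha'
        choose d hd using hPn
        have hbe : Function.extend (e j) b d ∘ e j = b := Function.extend_comp (he j) b d
        refine ⟨Function.extend (e j) b d, fun k _ => ?_, ?_, ?_⟩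
        · by_cases hk : ∃ y, e j y = k
          · obtain ⟨y, rfl⟩ := hk
            rw [(he j).extend_apply]
            exact hP j b hb y
          · rw [Function.extend_apply' _ _ _ hk]
            exact hd k
        · rw [mem_ofPred_eq, hbe]
          exact hb
        · rw [mem_ofPred_eq, ← hte i j j.2, hbe])
      (fun j => hbox.inter_right (hCcl j)) (fun j => hbox.isClosed.inter (hCcl j))
    rw [mem_iInter] at hx
    refine ⟨x, fun j => ?_, (hx ⟨i, le_rfl⟩).2.2⟩
    rcases le_total i j with h | h
    · exact (hx ⟨j, h⟩).2.1
    · exact hmono _ _ h x (hx ⟨i, le_rfl⟩).2.1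
  have hSn : S.Nonempty := by
    rcases isEmpty_or_nonempty I with _ | ⟨⟨i⟩⟩
    · exact ⟨0, isEmptyElim⟩
    · obtain ⟨a, ha⟩ := (f i).nonempty
      obtain ⟨x, hx, -⟩ := key i a ha
      exact ⟨x, hx⟩
  refine ⟨⟨S, hSn, hSc, fun a ha b hb s hs i => (f i).max_mem (ha i) (hb i) hs⟩, fun i => ?_⟩
  apply SetLike.coe_injective
  ext a
  constructor
  · rintro ⟨x, hx, rfl⟩
    exact hx i
  · exact fun ha => key i a ha

end Glue

section Tower

variable {ι : Type*} [LinearOrder ι]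

/-- Inclusion of initial segments. -/
def toIio (α : ι) (β : Iio α) : Iic (β : ι) → Iio α := Set.inclusion (Iic_subset_Iio.2 β.2)

/-- Inclusion of initial segments. -/
def toIic {α β : ι} (h : α ≤ β) : Iic α → Iic β := Set.inclusion (Iic_subset_Iic.2 h)

/-- Inclusion of the open initial segment into the closed one. -/
def IioToIic (α : ι) : Iio α → Iic α := Set.inclusion Iio_subset_Iic_self

theorem toIio_toIic (α : ι) (β γ : Iio α) (h : β ≤ γ) (x : Iic (β : ι)) :
    toIio α γ (toIic (show (β : ι) ≤ γ from h) x) = toIio α β x := rfl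

theorem exists_toIio_eq (α : ι) (k : Iio α) : ∃ β x, toIio α β x = k :=
  ⟨k, ⟨k, le_rfl⟩, rfl⟩

/-- The element of the hyperspace over `Iio α` glued from a family over smaller segments. -/
noncomputable def glueIio (α : ι) (f : ∀ β : Iio α, Mpc (Iic (β : ι))) : Mpc (Iio α) :=
  Classical.epsilon fun A => ∀ β, res (toIio α β) A = f β

theorem res_glueIio {α : ι} {f : ∀ β : Iio α, Mpc (Iic (β : ι))}
    (hf : ∀ β γ : Iio α, ∀ h : (β : ι) ≤ γ, res (toIic h) (f γ) = f β) (β : Iio α) :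
    res (toIio α β) (glueIio α f) = f β :=
  Classical.epsilon_spec (exists_res_eq_of_coherent
    (fun β => Set.inclusion_injective (Iic_subset_Iio.2 β.2))
    (toIio_toIic α) (exists_toIio_eq α) f hf) β

/-- The restrictions to closed initial segments of the element with given coordinates. -/
noncomputable def build [WellFoundedLT ι]
    (H : ∀ α : ι, Mpc (Iic α) × (ℕ → ℝ) ≃ₜ Mpc (Iio α) × (ℕ → ℝ))
    (w : ι → ℕ → ℝ) (α : ι) : Mpc (Iic α) :=
  ((H α).symm (glueIio α fun β => build H w β, w α)).1
termination_by wellFounded_lt.wrap α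
decreasing_by exact β.2

variable [WellFoundedLT ι] {H : ∀ α : ι, Mpc (Iic α) × (ℕ → ℝ) ≃ₜ Mpc (Iio α) × (ℕ → ℝ)}

theorem res_build (hH : ∀ α x, (H α x).1 = res (IioToIic α) x.1) (w : ι → ℕ → ℝ) (β : ι) :
    ∀ α (h : α ≤ β), res (toIic h) (build H w β) = build H w α := by
  induction β using WellFoundedLT.induction with
  | ind β ih =>
    intro α h
    rcases h.eq_or_lt with rfl | hlt
    · exact res_id _
    · have h₁ : res (IioToIic β) (build H w β) = glueIio β fun γ => build H w γ := by
        rw [build, ← hH, Homeomorph.apply_symm_apply]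
      rw [show toIic h = IioToIic β ∘ toIio β ⟨α, hlt⟩ from rfl, ← res_res, h₁]
      exact res_glueIio (fun γ δ hγδ => ih δ δ.2 γ hγδ) ⟨α, hlt⟩

theorem continuous_glueIio_build (hH : ∀ α x, (H α x).1 = res (IioToIic α) x.1) (α : ι)
    (hc : ∀ β < α, Continuous fun w => build H w β) :
    Continuous fun w => glueIio α fun β => build H w β := by
  refine continuous_iff_continuousAt.2 fun w =>
    tendsto_of_res (toIio_toIic α) (exists_toIio_eq α) fun β => ?_
  have hb : ∀ w, res (toIio α β) (glueIio α fun γ => build H w γ) = build H w β := fun w =>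
    res_glueIio (fun γ δ hγδ => res_build hH w δ γ hγδ) β
  simp only [hb]
  exact (hc β β.2).tendsto w

theorem continuous_build (hH : ∀ α x, (H α x).1 = res (IioToIic α) x.1) (α : ι) :
    Continuous fun w => build H w α := by
  induction α using WellFoundedLT.induction with
  | ind α ih =>
    have := continuous_glueIio_build hH α ih
    have h : (fun w => build H w α) =
        fun w => ((H α).symm (glueIio α fun β => build H w β, w α)).1 := by
      funext w
      rw [build]
    rw [h]
    fun_prop

/-- Compatible product decompositions along a well-ordered tower give one for the whole space. -/
theorem nonempty_homeomorph_of_tower (hH : ∀ α x, (H α x).1 = res (IioToIic α) x.1) :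
    Nonempty (Mpc ι × (ι → ℕ → ℝ) ≃ₜ (ι → ℕ → ℝ)) := by
  have ht : ∀ (α β : ι) (h : α ≤ β) (x : Iic α), ((toIic h x : Iic β) : ι) = x :=
    fun _ _ _ _ => rfl
  have hcov : ∀ k : ι, ∃ α, ∃ x : Iic α, (x : ι) = k := fun k => ⟨k, ⟨k, le_rfl⟩, rfl⟩
  have hglue : ∀ w : ι → ℕ → ℝ, ∃ A : Mpc ι, ∀ α,
      res (Subtype.val : Iic α → ι) A = build H w α := fun w =>
    exists_res_eq_of_coherent (fun _ => Subtype.val_injective) ht hcov _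
      fun α β h => res_build hH w β α h
  choose D hD using hglue
  have hG : ∀ α w, (glueIio α fun β => build H w β) = res (Subtype.val : Iio α → ι) (D w) :=
    fun α w => eq_of_res_eq (toIio_toIic α) (exists_toIio_eq α) fun β => by
      rw [res_glueIio (fun γ δ hγδ => res_build hH w δ γ hγδ), res_res, ← hD]
      rfl
  have hDc : Continuous D := continuous_iff_continuousAt.2 fun w => tendsto_of_res ht hcov
    fun α => by simpa only [hD] using (continuous_build hH α).tendsto w
  have hpair : ∀ (w : ι → ℕ → ℝ) α,
      (res (Subtype.val : Iic α → ι) (D w),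
        ((H α).symm (res (Subtype.val : Iio α → ι) (D w), w α)).2) =
      (H α).symm (res (Subtype.val : Iio α → ι) (D w), w α) := by
    intro w α
    refine Prod.ext ?_ rfl
    simp only
    rw [hD, build, hG]
  have hHval : ∀ α (A : Mpc ι) v, H α (res (Subtype.val : Iic α → ι) A, v) =
      (res (Subtype.val : Iio α → ι) A, (H α (res (Subtype.val : Iic α → ι) A, v)).2) := by
    intro α A v
    refine Prod.ext ?_ rfl
    rw [hH, res_res]
    rfl
  have huniq : ∀ (A : Mpc ι) (v w : ι → ℕ → ℝ),
      (∀ α, (H α (res (Subtype.val : Iic α → ι) A, v α)).2 = w α) → D w = A := by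
    intro A v w hw
    refine eq_of_res_eq ht hcov fun α => ?_
    induction α using WellFoundedLT.induction with
    | ind α ih =>
      have h₁ : res (Subtype.val : Iio α → ι) (D w) = res Subtype.val A :=
        eq_of_res_eq (toIio_toIic α) (exists_toIio_eq α) fun β => by
          rw [res_res, res_res]
          exact ih β β.2
      have h₂ : (H α).symm (res (Subtype.val : Iio α → ι) (D w), w α) =
          (res (Subtype.val : Iic α → ι) A, v α) := by
        rw [Homeomorph.symm_apply_eq, hHval, h₁, hw]
      exact (congrArg Prod.fst (hpair w α)).trans (congrArg Prod.fst h₂)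
  have hres := fun α => continuous_res (Subtype.val : Iic α → ι)
  have hres' := fun α => continuous_res (Subtype.val : Iio α → ι)
  refine ⟨{
    toFun := fun p α => (H α (res (Subtype.val : Iic α → ι) p.1, p.2 α)).2
    invFun := fun w =>
      (D w, fun α => ((H α).symm (res (Subtype.val : Iio α → ι) (D w), w α)).2)
    left_inv := ?_
    right_inv := ?_
    continuous_toFun := ?_
    continuous_invFun := ?_ }⟩
  · rintro ⟨A, v⟩
    simp only
    rw [huniq A v _ fun α => rfl]
    refine Prod.ext rfl (funext fun α => ?_)
    simp only
    rw [← hHval, Homeomorph.symm_apply_apply]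
  · intro w
    funext α
    simp only
    rw [hpair, Homeomorph.apply_symm_apply]
  · fun_prop
  · fun_prop

end Tower

section Translate

variable {κ : Type*}

/-- The translate of `A` by the vector `c`. -/
def translate (c : κ → ℝ) (A : Mpc κ) : Mpc κ :=
  ⟨(· + c) '' (A : Set (κ → ℝ)), A.nonempty.image _,
    A.isCompact.image (continuous_id.add continuous_const), by
      rintro _ ⟨a, ha, rfl⟩ _ ⟨b, hb, rfl⟩ t ht
      refine ⟨_, A.max_mem ha hb ht, funext fun i => ?_⟩
      simp only [Pi.add_apply, ← add_assoc, max_add_add_right]⟩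

theorem mem_translate {c x : κ → ℝ} {A : Mpc κ} : x ∈ translate c A ↔ ∃ a ∈ A, a + c = x := Iff.rfl

theorem add_mem_translate {a : κ → ℝ} {A : Mpc κ} (ha : a ∈ A) (c : κ → ℝ) :
    a + c ∈ translate c A :=
  ⟨a, ha, rfl⟩

theorem translate_translate (c d : κ → ℝ) (A : Mpc κ) :
    translate c (translate d A) = translate (d + c) A := by
  refine SetLike.ext fun x => ?_
  simp [mem_translate, add_assoc]

theorem translate_zero (A : Mpc κ) : translate 0 A = A := by
  refine SetLike.ext fun x => ?_
  simp [mem_translate]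

theorem continuous_translate : Continuous fun p : (κ → ℝ) × Mpc κ => translate p.1 p.2 := by
  refine continuous_iff_continuousAt.2 fun ⟨c, A⟩ => (hasBasis_nhds _).tendsto_right_iff.2 ?_
  rintro ⟨F, ε⟩ (hε : 0 < ε)
  have hc : ∀ᶠ d : κ → ℝ in 𝓝 c, ∀ i ∈ F, |c i - d i| < ε / 2 := by
    refine F.eventually_all.2 fun i _ => ?_
    have hcont : Continuous fun d : κ → ℝ => |c i - d i| := by fun_prop
    exact hcont.continuousAt.eventually_lt continuousAt_const (by simpa using half_pos hε)
  have hA : ∀ᶠ B in 𝓝 A, Close F (ε / 2) A B :=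
    (hasBasis_nhds A).mem_of_mem (i := (F, ε / 2)) (half_pos hε)
  have key : ∀ {a b c d : ℝ}, |c - d| < ε / 2 → |a - b| < ε / 2 → |a + c - (b + d)| < ε := by
    intro a b c d h₁ h₂
    rw [abs_lt] at *
    constructor <;> linarith
  rw [nhds_prod_eq]
  filter_upwards [hc.prod_mk hA] with ⟨d, B⟩ ⟨hd, hAB, hBA⟩
  constructor
  · rintro _ ⟨a, ha, rfl⟩
    obtain ⟨b, hb, h⟩ := hAB a ha
    exact ⟨_, add_mem_translate hb d, fun i hi => key (hd i hi) (h i hi)⟩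
  · rintro _ ⟨b, hb, rfl⟩
    obtain ⟨a, ha, h⟩ := hBA b hb
    exact ⟨_, add_mem_translate ha c, fun i hi => key (hd i hi) (h i hi)⟩

/-- The coordinatewise supremum of `A`. -/
noncomputable def top (A : Mpc κ) : κ → ℝ := fun i => supp (fun x => x i) A

theorem continuous_top : Continuous (top (κ := κ)) :=
  continuous_pi fun i => continuous_supp (continuous_apply i)

theorem top_translate (c : κ → ℝ) (A : Mpc κ) : top (translate c A) = top A + c := by
  funext i
  have hi : Continuous fun x : κ → ℝ => x i := continuous_apply i
  refine le_antisymm ((supp_le_iff hi).2 ?_) ?_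
  · rintro _ ⟨a, ha, rfl⟩
    exact add_le_add_left (le_supp hi ha) _
  · obtain ⟨a, ha, h⟩ := exists_mem_eq_supp hi A
    rw [Pi.add_apply, top, ← h]
    exact le_supp hi (add_mem_translate ha c)

/-- A homeomorphism between `(κ → ℝ) × (κ → ℝ)` and `κ → ℝ` makes `Mpc κ` absorb a factor
`κ → ℝ`. -/
noncomputable def absorb (j : (κ → ℝ) × (κ → ℝ) ≃ₜ (κ → ℝ)) : Mpc κ × (κ → ℝ) ≃ₜ Mpc κ where
  toFun p := translate (j (top p.1, p.2) - top p.1) p.1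
  invFun B := (translate ((j.symm (top B)).1 - top B) B, (j.symm (top B)).2)
  left_inv := by
    rintro ⟨A, c⟩
    simp [top_translate, translate_translate, translate_zero]
  right_inv B := by
    simp [top_translate, translate_translate, translate_zero]
  continuous_toFun := by
    have := continuous_top (κ := κ)
    exact continuous_translate.comp (f := fun p : Mpc κ × (κ → ℝ) =>
      (j (top p.1, p.2) - top p.1, p.1)) (by fun_prop)
  continuous_invFun := by
    have := continuous_top (κ := κ)
    exact (continuous_translate.comp (f := fun B : Mpc κ =>
      ((j.symm (top B)).1 - top B, B)) (by fun_prop)).prodMk (by fun_prop)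

end Translate

/-- Currying as a homeomorphism of function spaces with the product topologies. -/
def curryHomeomorph (α β X : Type*) [TopologicalSpace X] : (α × β → X) ≃ₜ (α → β → X) where
  toEquiv := Equiv.curry α β X
  continuous_toFun := continuous_pi fun a => continuous_pi fun b => continuous_apply (a, b)
  continuous_invFun :=
    continuous_pi fun p => (continuous_apply p.2).comp (continuous_apply p.1)

theorem nonempty_homeomorph_of_mk_eq_aleph_one {ι : Type*}
    (hι : Cardinal.mk ι = Cardinal.aleph 1) : Nonempty (Mpc ι ≃ₜ (ι → ℝ)) := by
  have hinf : Cardinal.aleph0 ≤ Cardinal.mk ι := hι ▸ Cardinal.aleph0_le_aleph 1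
  obtain ⟨f⟩ : Nonempty (ι ⊕ ι ≃ ι) := Cardinal.eq.1 (by simp [Cardinal.add_eq_self hinf])
  obtain ⟨g⟩ : Nonempty (ι × ℕ ≃ ι) := by
    have : Infinite ι := Cardinal.aleph0_le_mk_iff.1 hinf
    refine Cardinal.eq.1 ?_
    simp
  obtain ⟨_, _, hr⟩ := Cardinal.exists_ord_eq_type_lt ι
  have hIic : ∀ α : ι, Countable (Iic α) := fun α => by
    have := Cardinal.mk_Iic_lt α hr hinf
    rwa [hι, Cardinal.lt_aleph_one_iff, Cardinal.mk_le_aleph0_iff] at this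
  have hIio : ∀ α : ι, Countable (Iio α) := fun α =>
    (inclusion_injective Iio_subset_Iic_self : Function.Injective (IioToIic α)).countable
  choose H hH using fun α : ι =>
    exists_homeomorph_over_res (e := IioToIic α) (inclusion_injective Iio_subset_Iic_self)
  obtain ⟨T⟩ := nonempty_homeomorph_of_tower hH
  let c : (ι → ℕ → ℝ) ≃ₜ (ι → ℝ) :=
    (curryHomeomorph ι ℕ ℝ).symm.trans (Homeomorph.piCongrLeft (Y := fun _ => ℝ) g)
  let j : (ι → ℝ) × (ι → ℝ) ≃ₜ (ι → ℝ) :=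
    Homeomorph.sumArrowHomeomorphProdArrow.symm.trans (Homeomorph.piCongrLeft (Y := fun _ => ℝ) f)
  exact ⟨(absorb j).symm.trans
    (((Homeomorph.refl (Mpc ι)).prodCongr c.symm).trans (T.trans c))⟩

end Mpc

end
/-- For a type `ι` of cardinality `ℵ₁`, the hyperspace of nonempty compact max-plus
convex subsets of `ι → ℝ` (product topology), with the Vietoris topology, is
homeomorphic to `ι → ℝ`. -/
theorem mpcc_aleph_one_homeomorph (ι : Type*)
    (hι : Cardinal.mk ι = Cardinal.aleph 1) :
    letI : TopologicalSpace {A : Set (ι → ℝ) // A.Nonempty ∧ IsCompact A ∧ MaxPlusConvex A} :=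
      vietoris _
    Nonempty ({A : Set (ι → ℝ) // A.Nonempty ∧ IsCompact A ∧ MaxPlusConvex A} ≃ₜ (ι → ℝ)) := by
  exact Mpc.nonempty_homeomorph_of_mk_eq_aleph_one hι
end

section
/- Let ι be a type whose cardinality is strictly greater than ℵ₁, and let mpcc(ι → ℝ) denote the set of all nonempty compact max-plus convex subsets of ι → ℝ (product topology) with the Vietoris topology. Then mpcc(ι → ℝ) is not an absolute extensor: there do not exist a type J, a continuous map f : (J → ℝ) → [0,1] with U = f⁻¹((0,1]), and continuous maps s : mpcc(ι → ℝ) → U and r : U → mpcc(ι → ℝ) (U carrying the subspace topology of the product topology on J → ℝ) such that r ∘ s is the identity of mpcc(ι → ℝ). -/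
universe u v

open Filter Topology

/-- Kuratowski's free set theorem for pairs and finite-valued set mappings. -/
theorem exists_free_triple {ι : Type*} (hι : Cardinal.aleph 1 < Cardinal.mk ι)
    (G : ι → ι → Set ι) (hG : ∀ a b, (G a b).Finite) :
    ∃ a b c, a ≠ c ∧ c ∉ G a b ∧ b ∉ G a c ∧ a ∉ G b c := by
  obtain ⟨S, hS⟩ := Cardinal.le_mk_iff_exists_set.1 hι.le
  have hω : Cardinal.aleph0 ≤ Cardinal.aleph 1 := Cardinal.aleph0_le_aleph 1
  obtain ⟨c, hc⟩ : ∃ c, c ∉ S ∪ ⋃ p : S × S, G p.1 p.2 := by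
    by_contra! h
    have hle : Cardinal.mk ↥(S ∪ ⋃ p : S × S, G p.1 p.2) ≤ Cardinal.aleph 1 := by
      refine (Cardinal.mk_union_le _ _).trans (Cardinal.add_le_of_le hω hS.le ?_)
      refine (Cardinal.mk_iUnion_le _).trans (Cardinal.mul_le_of_le hω ?_ ?_)
      · rw [Cardinal.mk_prod, Cardinal.lift_id, hS, Cardinal.mul_eq_self hω]
      · exact ciSup_le' fun p => ((hG _ _).lt_aleph0.le).trans hω
    rw [Set.eq_univ_of_forall h, Cardinal.mk_univ] at hle
    exact hι.not_ge hle
  simp only [Set.mem_union, Set.mem_iUnion, not_or, not_exists] at hc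
  have hSc : ¬ S.Countable := by
    rw [← Cardinal.le_aleph0_iff_set_countable, hS, not_le]
    exact Cardinal.aleph0_lt_aleph_one
  have hSi : S.Infinite := fun h => hSc h.countable
  obtain ⟨T, hTS, hTi, hTc⟩ : ∃ T ⊆ S, T.Infinite ∧ T.Countable := by
    refine ⟨Set.range fun n => (hSi.natEmbedding S n : ι), ?_, ?_, Set.countable_range _⟩
    · rintro _ ⟨n, rfl⟩
      exact (hSi.natEmbedding S n).2
    · exact Set.infinite_range_of_injective
        (Subtype.val_injective.comp (hSi.natEmbedding S).injective)
  obtain ⟨b, hbS, hb⟩ : ∃ b ∈ S, b ∉ ⋃ a ∈ T, G a c := by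
    by_contra! h
    exact hSc ((hTc.biUnion fun a _ => (hG a c).countable).mono h)
  obtain ⟨a, haT, ha⟩ := hTi.exists_notMem_finite (hG b c)
  simp only [Set.mem_iUnion, not_exists] at hb
  refine ⟨a, b, c, ?_, hc.2 (⟨a, hTS haT⟩, ⟨b, hbS⟩), hb a haT, ha⟩
  rintro rfl
  exact hc.1 (hTS haT)

/-- Finitely many basic conditions on a real-valued function, each within `δ k` of `z k` on `E k`,
can be satisfied simultaneously when they are approximately compatible. -/
theorem exists_common_approximation {J κ : Type*} [Finite κ] (E : κ → Set J) (z : κ → J → ℝ)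
    (q : J → ℝ) (δ : κ → ℝ) (hδ : ∀ k, 0 < δ k)
    (h : ∀ k l, k ≠ l → ∀ j ∈ E k, j ∈ E l → |z l j - q j| < δ k) :
    ∃ y : J → ℝ, ∀ k, ∀ j ∈ E k, |y j - z k j| < 2 * δ k := by
  have key : ∀ j, ∃ t : ℝ, ∀ k, j ∈ E k → |t - z k j| < 2 * δ k := by
    intro j
    by_cases hne : {k | j ∈ E k}.Nonempty
    · obtain ⟨l, hl, hmin⟩ := Set.exists_min_image {k | j ∈ E k} δ (Set.toFinite _) hne
      refine ⟨z l j, fun k hk => ?_⟩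
      have hle := hmin k hk
      have hpos := hδ k
      by_cases hkl : k = l
      · subst hkl
        simpa using hpos
      · have h₁ := abs_lt.1 (h k l hkl j hk hl)
        have h₂ := abs_lt.1 (h l k (Ne.symm hkl) j hl hk)
        exact abs_lt.2 ⟨by linarith [h₁.1, h₂.2], by linarith [h₁.2, h₂.1]⟩
    · exact ⟨0, fun k hk => absurd ⟨k, hk⟩ hne⟩
  choose y hy using key
  exact ⟨y, fun k j hj => hy j k hj⟩

/-- An open subset of a power of the real line contains a uniform finite-dimensional box
around each of its points. -/
theorem IsOpen.exists_finset_box_subset {J : Type*} {O : Set (J → ℝ)} (hO : IsOpen O)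
    {z : J → ℝ} (hz : z ∈ O) :
    ∃ (E : Finset J) (δ : ℝ), 0 < δ ∧ ∀ y : J → ℝ, (∀ j ∈ E, |y j - z j| < δ) → y ∈ O := by
  obtain ⟨E, u, hu, hsub⟩ := isOpen_pi_iff.1 hO z hz
  have hev : ∀ᶠ δ in 𝓝[>] (0 : ℝ), ∀ j ∈ E, Metric.ball (z j) δ ⊆ u j := by
    rw [eventually_all_finset]
    intro j hj
    obtain ⟨ε, hε, hb⟩ := Metric.isOpen_iff.1 (hu j hj).1 _ (hu j hj).2
    filter_upwards [Ioo_mem_nhdsGT hε] with δ hδ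
    exact (Metric.ball_subset_ball hδ.2.le).trans hb
  obtain ⟨δ, hδ, hpos⟩ := (hev.and self_mem_nhdsWithin).exists
  exact ⟨E, δ, hpos, fun y hy => hsub fun j hj => hδ j hj (hy j hj)⟩

/-- A space is not a retract of an open subspace of a power of the real line if it contains a
family indexed by pairs from a set of size greater than `ℵ₁`, converging to `Q`, for which local
conditions `V a b` at `K a b`, `V b c` at `K b c` and `W a c` at `Q` are never jointly
satisfiable. -/
theorem not_retract_of_convergent_pairs {ι X J : Type*} [TopologicalSpace X]
    (hι : Cardinal.aleph 1 < Cardinal.mk ι) (Q : X) (K : ι → ι → X)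
    (hK : Tendsto (fun p : ι × ι => K p.1 p.2) cofinite (𝓝 Q))
    (V W : ι → ι → Set X) (hV : ∀ a b, IsOpen (V a b)) (hW : ∀ a b, IsOpen (W a b))
    (hKV : ∀ a b, K a b ∈ V a b) (hQW : ∀ a b, a ≠ b → Q ∈ W a b)
    (hVW : ∀ a b c x, x ∈ V a b → x ∈ V b c → x ∉ W a c)
    {U : Set (J → ℝ)} (hU : IsOpen U) (s : X → U) (r : U → X)
    (hs : Continuous s) (hr : Continuous r) (hrs : ∀ x, r (s x) = x) : False := by
  have hbox : ∀ (x : X) (O : Set X), IsOpen O → x ∈ O →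
      ∃ (E : Finset J) (δ : ℝ), 0 < δ ∧ ∀ y : J → ℝ,
        (∀ j ∈ E, |y j - (s x : J → ℝ) j| < δ) → ∃ hy : y ∈ U, r ⟨y, hy⟩ ∈ O := by
    intro x O hO hx
    have hopen := hU.isOpenMap_subtype_val _ (hO.preimage hr)
    obtain ⟨E, δ, hδ, h⟩ := hopen.exists_finset_box_subset (z := s x)
      ⟨s x, by simpa [hrs] using hx, rfl⟩
    refine ⟨E, δ, hδ, fun y hy => ?_⟩
    obtain ⟨w, hw, rfl⟩ := h y hy
    exact ⟨w.2, hw⟩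
  have hpair : ∀ a b, ∃ (E : Finset J) (δ : ℝ), 0 < δ ∧
      (∀ y : J → ℝ, (∀ j ∈ E, |y j - (s (K a b) : J → ℝ) j| < 2 * δ) →
        ∃ hy : y ∈ U, r ⟨y, hy⟩ ∈ V a b) ∧
      (a ≠ b → ∀ y : J → ℝ, (∀ j ∈ E, |y j - (s Q : J → ℝ) j| < 2 * δ) →
        ∃ hy : y ∈ U, r ⟨y, hy⟩ ∈ W a b) := by
    classical
    intro a b
    obtain ⟨E₁, δ₁, hδ₁, h₁⟩ := hbox _ _ (hV a b) (hKV a b)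
    by_cases hab : a = b
    · refine ⟨E₁, δ₁ / 2, by positivity, fun y hy => h₁ y fun j hj => ?_, fun h => absurd hab h⟩
      linarith [hy j hj]
    · obtain ⟨E₂, δ₂, hδ₂, h₂⟩ := hbox _ _ (hW a b) (hQW a b hab)
      refine ⟨E₁ ∪ E₂, min δ₁ δ₂ / 2, by positivity, fun y hy => h₁ y fun j hj => ?_,
        fun _ y hy => h₂ y fun j hj => ?_⟩
      · linarith [hy j (Finset.mem_union_left _ hj), min_le_left δ₁ δ₂]
      · linarith [hy j (Finset.mem_union_right _ hj), min_le_right δ₁ δ₂]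
  choose E δ hδ hEV hEW using hpair
  have hfin : ∀ (j : J) (ε : ℝ), 0 < ε →
      {p : ι × ι | ¬ |(s (K p.1 p.2) : J → ℝ) j - (s Q : J → ℝ) j| < ε}.Finite := by
    intro j ε hε
    have hcont : Continuous fun x : X => (s x : J → ℝ) j :=
      (continuous_apply j).comp (continuous_subtype_val.comp hs)
    have ht := ((hcont.tendsto Q).comp hK).eventually (Metric.ball_mem_nhds _ hε)
    exact ht
  let B (a b : ι) : Set (ι × ι) := ⋃ j ∈ E a b,
    {p : ι × ι | ¬ |(s (K p.1 p.2) : J → ℝ) j - (s Q : J → ℝ) j| < δ a b}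
  have hB : ∀ a b, (B a b).Finite := fun a b =>
    (E a b).finite_toSet.biUnion fun j _ => hfin j _ (hδ a b)
  obtain ⟨a, b, c, hac, hc, hb, ha⟩ := exists_free_triple hι
    (fun a b => Prod.fst '' B a b ∪ Prod.snd '' B a b)
    fun a b => ((hB a b).image _).union ((hB a b).image _)
  have hfst : ∀ {d e x y : ι}, x ∉ Prod.fst '' B d e ∪ Prod.snd '' B d e →
      ∀ j ∈ E d e, |(s (K x y) : J → ℝ) j - (s Q : J → ℝ) j| < δ d e := by
    intro d e x y hx j hj
    by_contra hlt
    exact hx (Or.inl ⟨(x, y), Set.mem_biUnion hj hlt, rfl⟩)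
  have hsnd : ∀ {d e x y : ι}, y ∉ Prod.fst '' B d e ∪ Prod.snd '' B d e →
      ∀ j ∈ E d e, |(s (K x y) : J → ℝ) j - (s Q : J → ℝ) j| < δ d e := by
    intro d e x y hy j hj
    by_contra hlt
    exact hy (Or.inr ⟨(x, y), Set.mem_biUnion hj hlt, rfl⟩)
  obtain ⟨y, hy⟩ := exists_common_approximation
    ![(E a b : Set J), (E b c : Set J), (E a c : Set J)]
    ![(s (K a b) : J → ℝ), (s (K b c) : J → ℝ), (s Q : J → ℝ)] (s Q : J → ℝ)
    ![δ a b, δ b c, δ a c]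
    (by intro k; fin_cases k <;> simp [hδ])
    (by
      intro k l hkl j hk hl
      fin_cases k <;> fin_cases l <;> first | exact absurd rfl hkl | skip
      · exact hsnd hc j hk
      · simpa using hδ a b
      · exact hfst ha j hk
      · simpa using hδ b c
      · exact hsnd hb j hk
      · exact hfst hb j hk)
  obtain ⟨hyU, h₁⟩ := hEV a b y (hy 0)
  obtain ⟨_, h₂⟩ := hEV b c y (hy 1)
  obtain ⟨_, h₃⟩ := hEW a c hac y (hy 2)
  exact hVW a b c _ h₁ h₂ h₃

/-- The part of the unit cube where the coordinates `a` and `b` agree. -/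
def cubeDiagonal {ι : Type*} (a b : ι) : Set (ι → ℝ) :=
  Set.Icc 0 1 ∩ {x | x a = x b}

theorem maxPlusConvex_Icc {ι : Type*} : MaxPlusConvex (Set.Icc (0 : ι → ℝ) 1) := by
  intro x hx y hy t ht
  refine ⟨fun i => (hx.1 i).trans (le_max_left _ _), fun i => max_le (hx.2 i) ?_⟩
  have := hy.2 i
  simp only [Pi.one_apply] at this ⊢
  linarith

theorem maxPlusConvex_cubeDiagonal {ι : Type*} (a b : ι) :
    MaxPlusConvex (cubeDiagonal a b) := by
  intro x hx y hy t ht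
  refine ⟨maxPlusConvex_Icc x hx.1 y hy.1 t ht, ?_⟩
  have h₁ : x a = x b := hx.2
  have h₂ : y a = y b := hy.2
  simp [h₁, h₂]

theorem isCompact_unitCube {ι : Type*} : IsCompact (Set.Icc (0 : ι → ℝ) 1) := by
  rw [← Set.pi_univ_Icc]
  exact isCompact_univ_pi fun _ => isCompact_Icc

theorem isCompact_cubeDiagonal {ι : Type*} (a b : ι) : IsCompact (cubeDiagonal a b) :=
  isCompact_unitCube.inter_right (isClosed_eq (continuous_apply a) (continuous_apply b))

/-- An open set meeting the unit cube meets all but finitely many of the sets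
`cubeDiagonal a b`. -/
theorem eventually_cubeDiagonal_inter_nonempty {ι : Type*} {O : Set (ι → ℝ)} (hO : IsOpen O)
    (h : (Set.Icc 0 1 ∩ O).Nonempty) :
    ∀ᶠ p : ι × ι in cofinite, (cubeDiagonal p.1 p.2 ∩ O).Nonempty := by
  classical
  obtain ⟨x, hx, hxO⟩ := h
  obtain ⟨F, δ, hδ, hF⟩ := hO.exists_finset_box_subset hxO
  have hupdate : ∀ i k, Function.update x i (x k) ∈ Set.Icc (0 : ι → ℝ) 1 := by
    intro i k
    refine ⟨le_update_iff.2 ⟨hx.1 k, fun j _ => hx.1 j⟩,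
      update_le_iff.2 ⟨hx.2 k, fun j _ => hx.2 j⟩⟩
  have hmem : ∀ i ∉ F, ∀ t, Function.update x i t ∈ O := by
    intro i hi t
    refine hF _ fun j hj => ?_
    rw [Function.update_of_ne (ne_of_mem_of_not_mem hj hi)]
    simpa using hδ
  filter_upwards [(F ×ˢ F).finite_toSet.compl_mem_cofinite] with p hp
  have hp' : p.1 ∉ F ∨ p.2 ∉ F := by
    by_contra! hcon
    exact hp (Finset.mem_coe.2 (Finset.mem_product.2 hcon))
  obtain ⟨a, b⟩ := p
  by_cases hab : a = b
  · exact ⟨x, ⟨hx, congrArg x hab⟩, hxO⟩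
  rcases hp' with ha | hb
  · exact ⟨_, ⟨hupdate a b, by simp [Function.update_of_ne (Ne.symm hab)]⟩, hmem a ha _⟩
  · exact ⟨_, ⟨hupdate b a, by simp [Function.update_of_ne hab]⟩, hmem b hb _⟩

/-- If `ι` has cardinality strictly greater than `ℵ₁`, then the hyperspace of nonempty
compact max-plus convex subsets of `ι → ℝ` (Vietoris topology) is not an absolute
extensor: it is not a retract of any functionally open subspace of a power of the
real line. -/
theorem mpcc_not_absolute_extensor (ι : Type u)
    (hι : Cardinal.aleph 1 < Cardinal.mk ι) :
    letI : TopologicalSpace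
        {A : Set (ι → ℝ) // A.Nonempty ∧ IsCompact A ∧ MaxPlusConvex A} := vietoris _
    ¬ ∃ (J : Type v) (f : (J → ℝ) → ℝ) (U : Set (J → ℝ)),
        Continuous f ∧ (∀ x, f x ∈ Set.Icc (0 : ℝ) 1) ∧ U = f ⁻¹' Set.Ioc 0 1 ∧
        ∃ (s : {A : Set (ι → ℝ) // A.Nonempty ∧ IsCompact A ∧ MaxPlusConvex A} → ↥U)
          (r : ↥U → {A : Set (ι → ℝ) // A.Nonempty ∧ IsCompact A ∧ MaxPlusConvex A}),
          Continuous s ∧ Continuous r ∧ ∀ A, r (s A) = A := by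
  classical
  letI : TopologicalSpace
      {A : Set (ι → ℝ) // A.Nonempty ∧ IsCompact A ∧ MaxPlusConvex A} := vietoris _
  rintro ⟨J, f, U, hf, hf01, rfl, s, r, hs, hr, hrs⟩
  have hU : IsOpen (f ⁻¹' Set.Ioc 0 1) := by
    have : f ⁻¹' Set.Ioc 0 1 = f ⁻¹' Set.Ioi 0 := by
      ext x
      exact ⟨fun h => h.1, fun h => ⟨h, (hf01 x).2⟩⟩
    rw [this]
    exact isOpen_Ioi.preimage hf
  have hzero : ∀ a b : ι, (0 : ι → ℝ) ∈ cubeDiagonal a b :=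
    fun a b => ⟨⟨le_rfl, zero_le_one⟩, rfl⟩
  let Q : {A : Set (ι → ℝ) // A.Nonempty ∧ IsCompact A ∧ MaxPlusConvex A} :=
    ⟨Set.Icc 0 1, ⟨0, le_rfl, zero_le_one⟩, isCompact_unitCube, maxPlusConvex_Icc⟩
  let K (a b : ι) : {A : Set (ι → ℝ) // A.Nonempty ∧ IsCompact A ∧ MaxPlusConvex A} :=
    ⟨cubeDiagonal a b, ⟨0, hzero a b⟩, isCompact_cubeDiagonal a b,
      maxPlusConvex_cubeDiagonal a b⟩
  have hK : Tendsto (fun p : ι × ι => K p.1 p.2) cofinite (𝓝 Q) := by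
    refine TopologicalSpace.tendsto_nhds_generateFrom_iff.2 ?_
    rintro _ ⟨O, hO, rfl | rfl⟩ hQ
    · exact Eventually.of_forall fun p => Set.inter_subset_left.trans hQ
    · exact eventually_cubeDiagonal_inter_nonempty hO hQ
  have hdist : ∀ a b : ι, Continuous fun x : ι → ℝ => |x a - x b| := fun a b => by fun_prop
  refine not_retract_of_convergent_pairs hι Q K hK
    (fun a b => {A | (A : Set (ι → ℝ)) ⊆ {x | |x a - x b| < 1 / 3}})
    (fun a b => {A | ((A : Set (ι → ℝ)) ∩ {x | 2 / 3 < |x a - x b|}).Nonempty})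
    (fun a b => TopologicalSpace.isOpen_generateFrom_of_mem
      ⟨_, isOpen_lt (hdist a b) continuous_const, Or.inl rfl⟩)
    (fun a b => TopologicalSpace.isOpen_generateFrom_of_mem
      ⟨_, isOpen_lt continuous_const (hdist a b), Or.inr rfl⟩)
    ?_ ?_ ?_ hU s r hs hr hrs
  · intro a b x hx
    have : x a = x b := hx.2
    simp [this]
  · intro a b hab
    refine ⟨Pi.single a 1, ⟨Pi.single_nonneg.2 zero_le_one, ?_⟩, ?_⟩
    · exact update_le_iff.2 ⟨le_rfl, fun j _ => zero_le_one⟩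
    · simp [Pi.single_eq_of_ne (Ne.symm hab)]
      norm_num
  · rintro a b c A hab hbc ⟨x, hxA, hx⟩
    have h₁ : |x a - x b| < 1 / 3 := hab hxA
    have h₂ : |x b - x c| < 1 / 3 := hbc hxA
    have h₃ : 2 / 3 < |x a - x c| := hx
    linarith [abs_sub_le (x a) (x b) (x c)]
end

section
/- There exist two distinct nonempty compact max-plus convex subsets D and D₁ of (ℕ → ℝ) × (ℕ → ℝ) × (ℕ → ℝ) whose images under the projection onto the first two factors coincide and whose images under the projection onto the first and third factors coincide. (For instance, one may take D = {(0, x, y) : x 0 ∈ [0,1], y 0 ∈ [0,1], x n = y n = 0 for n > 0} and D₁ = {(0, x, y) ∈ D : x 0 = y 0}.) Consequently, the commutative square obtained by applying the hyperspace construction mpcc to the square of coordinate projections among (ℕ→ℝ)³, (ℕ→ℝ)², and ℕ→ℝ is not a pullback square. -/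
/-- Max-plus convexity in the triple product `(ℕ → ℝ) × (ℕ → ℝ) × (ℕ → ℝ)`. -/
def MaxPlusConvex3 (A : Set ((ℕ → ℝ) × (ℕ → ℝ) × (ℕ → ℝ))) : Prop :=
  ∀ a ∈ A, ∀ b ∈ A, ∀ t : ℝ, t ≤ 0 →
    ((fun n => max (a.1 n) (t + b.1 n)),
      (fun n => max (a.2.1 n) (t + b.2.1 n)),
      (fun n => max (a.2.2 n) (t + b.2.2 n))) ∈ A

/-- Projection of the triple product onto the first two factors. -/
def pr12 (x : (ℕ → ℝ) × (ℕ → ℝ) × (ℕ → ℝ)) : (ℕ → ℝ) × (ℕ → ℝ) := (x.1, x.2.1)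

/-- Projection of the triple product onto the first and third factors. -/
def pr13 (x : (ℕ → ℝ) × (ℕ → ℝ) × (ℕ → ℝ)) : (ℕ → ℝ) × (ℕ → ℝ) := (x.1, x.2.2)

open Set

/-- The point `(0, x, y)` where `x` and `y` vanish off `0` and `(x 0, y 0) = p`. -/
noncomputable def spike (p : ℝ × ℝ) : (ℕ → ℝ) × (ℕ → ℝ) × (ℕ → ℝ) :=
  (0, Pi.single 0 p.1, Pi.single 0 p.2)

lemma continuous_spike : Continuous spike := by
  have h : Continuous fun r : ℝ => (Pi.single 0 r : ℕ → ℝ) :=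
    continuous_single (A := fun _ => ℝ) 0
  exact continuous_const.prodMk ((h.comp continuous_fst).prodMk (h.comp continuous_snd))

lemma spike_injective : Function.Injective spike := fun p q h => by
  simp only [spike, Prod.mk.injEq, Pi.single_inj, true_and] at h
  exact Prod.ext h.1 h.2

lemma max_add_single_zero (r s : ℝ) {t : ℝ} (ht : t ≤ 0) :
    (fun n => max ((Pi.single 0 r : ℕ → ℝ) n) (t + (Pi.single 0 s : ℕ → ℝ) n)) =
      Pi.single 0 (max r (t + s)) := by
  funext n
  rcases eq_or_ne n 0 with rfl | hn
  · simp
  · simp [hn, ht]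

lemma maxPlusConvex3_image_spike {S : Set (ℝ × ℝ)}
    (hS : ∀ p ∈ S, ∀ q ∈ S, ∀ t : ℝ, t ≤ 0 → (max p.1 (t + q.1), max p.2 (t + q.2)) ∈ S) :
    MaxPlusConvex3 (spike '' S) := by
  rintro _ ⟨p, hp, rfl⟩ _ ⟨q, hq, rfl⟩ t ht
  refine ⟨_, hS p hp q hq t ht, ?_⟩
  simp only [spike, max_add_single_zero _ _ ht, Prod.mk.injEq, and_true]
  funext n
  simp [ht]

lemma max_add_mem_Icc_zero_one {r s t : ℝ} (hr : r ∈ Icc (0 : ℝ) 1) (hs : s ∈ Icc (0 : ℝ) 1)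
    (ht : t ≤ 0) : max r (t + s) ∈ Icc (0 : ℝ) 1 :=
  ⟨le_max_of_le_left hr.1, max_le hr.2 (by linarith [hs.2])⟩

lemma exists_ne_maxPlusConvex3_image_eq :
    ∃ D D₁ : Set ((ℕ → ℝ) × (ℕ → ℝ) × (ℕ → ℝ)),
      (D.Nonempty ∧ IsCompact D ∧ MaxPlusConvex3 D) ∧
      (D₁.Nonempty ∧ IsCompact D₁ ∧ MaxPlusConvex3 D₁) ∧
      D ≠ D₁ ∧ pr12 '' D = pr12 '' D₁ ∧ pr13 '' D = pr13 '' D₁ := by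
  have h0 : (0 : ℝ) ∈ Icc (0 : ℝ) 1 := by simp
  have h1 : (1 : ℝ) ∈ Icc (0 : ℝ) 1 := by simp
  refine ⟨spike '' (Icc 0 1 ×ˢ Icc 0 1), spike '' ((fun r => (r, r)) '' Icc 0 1),
    ⟨⟨_, mem_image_of_mem _ (mk_mem_prod h0 h0)⟩,
      (isCompact_Icc.prod isCompact_Icc).image continuous_spike,
      maxPlusConvex3_image_spike fun p hp q hq t ht =>
        ⟨max_add_mem_Icc_zero_one hp.1 hq.1 ht, max_add_mem_Icc_zero_one hp.2 hq.2 ht⟩⟩,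
    ⟨⟨_, mem_image_of_mem _ (mem_image_of_mem _ h0)⟩,
      (isCompact_Icc.image (by fun_prop)).image continuous_spike,
      maxPlusConvex3_image_spike ?_⟩, fun h => ?_, ?_, ?_⟩
  · rintro _ ⟨r, hr, rfl⟩ _ ⟨s, hs, rfl⟩ t ht
    exact ⟨_, max_add_mem_Icc_zero_one hr hs ht, rfl⟩
  · rw [spike_injective.image_injective.eq_iff] at h
    obtain ⟨r, -, hr⟩ := h ▸ mk_mem_prod h0 h1
    simp only [Prod.mk.injEq] at hr
    exact zero_ne_one (hr.1.symm.trans hr.2)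
  · apply Subset.antisymm
    · rintro _ ⟨_, ⟨p, hp, rfl⟩, rfl⟩
      exact ⟨_, ⟨_, ⟨p.1, hp.1, rfl⟩, rfl⟩, rfl⟩
    · rintro _ ⟨_, ⟨_, ⟨r, hr, rfl⟩, rfl⟩, rfl⟩
      exact ⟨_, ⟨_, mk_mem_prod hr hr, rfl⟩, rfl⟩
  · apply Subset.antisymm
    · rintro _ ⟨_, ⟨p, hp, rfl⟩, rfl⟩
      exact ⟨_, ⟨_, ⟨p.2, hp.2, rfl⟩, rfl⟩, rfl⟩
    · rintro _ ⟨_, ⟨_, ⟨r, hr, rfl⟩, rfl⟩, rfl⟩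
      exact ⟨_, ⟨_, mk_mem_prod hr hr, rfl⟩, rfl⟩

/-- There are two distinct nonempty compact max-plus convex subsets of
`(ℕ → ℝ) × (ℕ → ℝ) × (ℕ → ℝ)` with the same images under the projections onto the
first-and-second and first-and-third factors; consequently the canonical map from
`mpcc((ℕ→ℝ)³)` to the pullback of `mpcc(pr₁) : mpcc((ℕ→ℝ)²) → mpcc(ℕ→ℝ)` against itself
is not injective, so the `mpcc` square is not a pullback square. -/
theorem mpcc_square_not_pullback :
    (∃ D D₁ : Set ((ℕ → ℝ) × (ℕ → ℝ) × (ℕ → ℝ)),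
      (D.Nonempty ∧ IsCompact D ∧ MaxPlusConvex3 D) ∧
      (D₁.Nonempty ∧ IsCompact D₁ ∧ MaxPlusConvex3 D₁) ∧
      D ≠ D₁ ∧ pr12 '' D = pr12 '' D₁ ∧ pr13 '' D = pr13 '' D₁) ∧
    ¬ Function.Injective
        (fun A : {A : Set ((ℕ → ℝ) × (ℕ → ℝ) × (ℕ → ℝ)) //
            A.Nonempty ∧ IsCompact A ∧ MaxPlusConvex3 A} =>
          (pr12 '' (A : Set ((ℕ → ℝ) × (ℕ → ℝ) × (ℕ → ℝ))),
            pr13 '' (A : Set ((ℕ → ℝ) × (ℕ → ℝ) × (ℕ → ℝ))))) := by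
  refine ⟨exists_ne_maxPlusConvex3_image_eq, fun h => ?_⟩
  obtain ⟨D, D₁, hD, hD₁, hne, h12, h13⟩ := exists_ne_maxPlusConvex3_image_eq
  exact hne (congrArg Subtype.val (@h ⟨D, hD⟩ ⟨D₁, hD₁⟩ (Prod.ext h12 h13)))
end

section
/- Let ι be any type and let A be a nonempty compact max-plus convex subset of ι → ℝ (product topology). Then for every i the supremum sup_{a ∈ A} a i is finite, and the pointwise supremum function fun i => sup_{a ∈ A} a i belongs to A. -/
/-- A nonempty compact directed set has a greatest element. -/
theorem IsCompact.exists_isGreatest_of_directedOn {α : Type*} [Preorder α] [TopologicalSpace α]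
    [ClosedIciTopology α] {s : Set α} (hs : IsCompact s) (hne : s.Nonempty)
    (hdir : DirectedOn (· ≤ ·) s) : ∃ m, IsGreatest s m := by
  have : Nonempty s := hne.to_subtype
  obtain ⟨m, hms, hm⟩ : (s ∩ ⋂ a : s, Set.Ici (a : α)).Nonempty := by
    refine hs.inter_iInter_nonempty _ (fun _ => isClosed_Ici) fun u => ?_
    have : IsDirectedOrder s := ⟨directedOn_iff_directed.mp hdir⟩
    obtain ⟨b, hb⟩ := u.exists_le
    exact ⟨b, b.2, Set.mem_iInter₂.mpr hb⟩
  exact ⟨m, hms, fun a ha => Set.mem_iInter.mp hm ⟨a, ha⟩⟩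

theorem MaxPlusConvex.supClosed {ι : Type*} {A : Set (ι → ℝ)} (hA : MaxPlusConvex A) :
    SupClosed A := fun a ha b hb => by
  simpa only [zero_add, ← Pi.sup_def] using hA a ha b hb 0 le_rfl

/-- For a nonempty compact max-plus convex subset `A` of `ι → ℝ` (product topology),
all coordinatewise suprema are finite and the pointwise supremum belongs to `A`. -/
theorem maxPlusConvex_sSup_mem {ι : Type*} (A : Set (ι → ℝ))
    (hne : A.Nonempty) (hc : IsCompact A) (hconv : MaxPlusConvex A) :
    (∀ i, BddAbove ((fun a => a i) '' A)) ∧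
      (fun i => sSup ((fun a => a i) '' A)) ∈ A := by
  obtain ⟨m, hmA, hm⟩ := hc.exists_isGreatest_of_directedOn hne hconv.supClosed.directedOn
  have hgreatest : ∀ i, IsGreatest ((fun a => a i) '' A) (m i) := fun i =>
    ⟨Set.mem_image_of_mem _ hmA, Set.forall_mem_image.mpr fun _ ha => hm ha i⟩
  refine ⟨fun i => (hgreatest i).bddAbove, ?_⟩
  simpa only [(hgreatest _).csSup_eq] using hmA
end

section
/- Let X be a topological space and f : X → [0,1] a continuous function. Then the map g, defined on the set of nonempty compact subsets of X endowed with the Vietoris topology by g(A) = inf_{a ∈ A} f(a), is continuous, and g⁻¹((0,1]) = { A : A ⊆ f⁻¹((0,1]) }. In particular, if M ⊆ X is functionally open, then the set of nonempty compact subsets of X contained in M is functionally open in the Vietoris hyperspace. -/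
/-- For a continuous `f : X → [0,1]`, the map `g(A) = inf_{a ∈ A} f a` on the Vietoris
hyperspace of nonempty compact subsets of `X` is continuous, takes values in `[0,1]`,
and `g⁻¹((0,1]) = {A | A ⊆ f⁻¹((0,1])}`; in particular, if `M ⊆ X` is functionally
open then `{A | A ⊆ M}` is functionally open in the hyperspace. -/
theorem hyperspace_inf_continuous_and_preimage (X : Type*) [TopologicalSpace X]
    (f : X → ℝ) (hf : Continuous f) (hf01 : ∀ x, f x ∈ Set.Icc (0 : ℝ) 1) :
    letI : TopologicalSpace {A : Set X // A.Nonempty ∧ IsCompact A} := vietoris _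
    (Continuous fun A : {A : Set X // A.Nonempty ∧ IsCompact A} =>
        sInf (f '' (A : Set X))) ∧
      (∀ A : {A : Set X // A.Nonempty ∧ IsCompact A},
        sInf (f '' (A : Set X)) ∈ Set.Icc (0 : ℝ) 1) ∧
      ((fun A : {A : Set X // A.Nonempty ∧ IsCompact A} =>
          sInf (f '' (A : Set X))) ⁻¹' Set.Ioc 0 1 =
        {A : {A : Set X // A.Nonempty ∧ IsCompact A} |
          (A : Set X) ⊆ f ⁻¹' Set.Ioc 0 1}) := by
  have lt_inf_iff (A : {A : Set X // A.Nonempty ∧ IsCompact A}) (a : ℝ) :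
      a < sInf (f '' (A : Set X)) ↔ ∀ x ∈ (A : Set X), a < f x :=
    A.2.2.lt_sInf_iff_of_continuous A.2.1 hf.continuousOn a
  have bddBelow_image (A : Set X) : BddBelow (f '' A) :=
    ⟨0, by rintro _ ⟨x, -, rfl⟩; exact (hf01 x).1⟩
  have inf_mem (A : {A : Set X // A.Nonempty ∧ IsCompact A}) :
      sInf (f '' (A : Set X)) ∈ Set.Icc (0 : ℝ) 1 := by
    obtain ⟨x, -, hx⟩ := (A.2.2.image hf).sInf_mem (A.2.1.image f)
    exact hx ▸ hf01 x
  letI : TopologicalSpace {A : Set X // A.Nonempty ∧ IsCompact A} := vietoris _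
  refine ⟨OrderTopology.continuous_iff.2 fun a => ⟨?_, ?_⟩, inf_mem, ?_⟩
  · refine TopologicalSpace.isOpen_generateFrom_of_mem
      ⟨f ⁻¹' Set.Ioi a, isOpen_Ioi.preimage hf, Or.inl ?_⟩
    ext A
    exact lt_inf_iff A a
  · refine TopologicalSpace.isOpen_generateFrom_of_mem
      ⟨f ⁻¹' Set.Iio a, isOpen_Iio.preimage hf, Or.inr ?_⟩
    ext A
    exact (csInf_lt_iff (bddBelow_image A) (A.2.1.image f)).trans Set.exists_mem_image
  · ext A
    exact ⟨fun h x hx => ⟨(lt_inf_iff A 0).1 h.1 x hx, (hf01 x).2⟩,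
      fun h => ⟨(lt_inf_iff A 0).2 fun x hx => (h hx).1, (inf_mem A).2⟩⟩
end

section
/- The hyperspace mpcc(ℝ^ω) of all nonempty compact max-plus convex subsets of ℕ → ℝ, topologized by the Hausdorff metric (equivalently, the Vietoris topology), is contractible. -/
/-- The hyperspace of nonempty compact max-plus convex subsets of `ℕ → ℝ`. -/
abbrev MPCC := {A : Set (ℕ → ℝ) // A.Nonempty ∧ IsCompact A ∧ MaxPlusConvex A}

/-- Scaling by a nonnegative real preserves max-plus convexity. -/
theorem MaxPlusConvex.image_smul {ι : Type*} {A : Set (ι → ℝ)} (hA : MaxPlusConvex A) {s : ℝ}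
    (hs : 0 ≤ s) : MaxPlusConvex ((fun x : ι → ℝ => s • x) '' A) := by
  rintro _ ⟨a, ha, rfl⟩ _ ⟨b, hb, rfl⟩ t ht
  rcases hs.eq_or_lt with rfl | hs
  · exact ⟨a, ha, by ext i; simp [ht]⟩
  · refine ⟨_, hA a ha b hb (t / s) (div_nonpos_of_nonpos_of_nonneg ht hs.le), ?_⟩
    ext i
    simp only [Pi.smul_apply, smul_eq_mul, mul_max_of_nonneg _ _ hs.le, mul_add,
      mul_div_cancel₀ t hs.ne']

/-- In the Vietoris topology, the image of a compact set under a jointly continuous family of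
maps depends continuously on the parameter and the set. -/
theorem continuous_vietoris_image {T X Y : Type*} [TopologicalSpace T] [TopologicalSpace X]
    [TopologicalSpace Y] {P : Set X → Prop} {Q : Set Y → Prop} (hP : ∀ A, P A → IsCompact A)
    {f : T × X → Y} (hf : Continuous f)
    (hQ : ∀ (t : T) (A : Set X), P A → Q ((fun x => f (t, x)) '' A)) :
    letI : TopologicalSpace {A : Set X // P A} := vietoris P
    letI : TopologicalSpace {B : Set Y // Q B} := vietoris Q
    Continuous fun p : T × {A : Set X // P A} =>
      (⟨(fun x => f (p.1, x)) '' p.2, hQ p.1 p.2 p.2.2⟩ : {B : Set Y // Q B}) := by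
  let _ : TopologicalSpace {A : Set X // P A} := vietoris P
  refine continuous_generateFrom_iff.mpr ?_
  rintro _ ⟨U, hU, rfl | rfl⟩ <;> refine isOpen_iff_mem_nhds.mpr ?_
  · rintro ⟨t, A⟩ hA
    obtain ⟨u, v, hu, hv, htu, hAv, huv⟩ := generalized_tube_lemma (isCompact_singleton (x := t))
      (hP A A.2) (hU.preimage hf) (by
        rintro ⟨_, x⟩ ⟨rfl, hx⟩
        exact hA ⟨x, hx, rfl⟩)
    have hv' : IsOpen {K : {A : Set X // P A} | (K : Set X) ⊆ v} :=
      TopologicalSpace.isOpen_generateFrom_of_mem ⟨v, hv, .inl rfl⟩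
    filter_upwards [(hu.prod hv').mem_nhds ⟨htu rfl, hAv⟩]
    rintro ⟨t', A'⟩ ⟨ht', hA'⟩ _ ⟨x, hx, rfl⟩
    exact huv ⟨ht', hA' hx⟩
  · rintro ⟨t, A⟩ ⟨_, ⟨x, hx, rfl⟩, hxU⟩
    obtain ⟨u, v, hu, hv, htu, hxv, huv⟩ := isOpen_prod_iff.mp (hU.preimage hf) t x hxU
    have hv' : IsOpen {K : {A : Set X // P A} | ((K : Set X) ∩ v).Nonempty} :=
      TopologicalSpace.isOpen_generateFrom_of_mem ⟨v, hv, .inr rfl⟩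
    filter_upwards [(hu.prod hv').mem_nhds ⟨htu, ⟨x, hx, hxv⟩⟩]
    rintro ⟨t', A'⟩ ⟨ht', y, hy, hyv⟩
    exact ⟨_, ⟨y, hy, rfl⟩, huv ⟨ht', hyv⟩⟩

/-- The hyperspace `mpcc(ℝ^ω)` of nonempty compact max-plus convex subsets of `ℕ → ℝ`,
with the Vietoris (equivalently, Hausdorff metric) topology, is contractible. -/
theorem mpcc_contractible :
    letI : TopologicalSpace MPCC := vietoris _
    ContractibleSpace MPCC := by
  let _ : TopologicalSpace MPCC := vietoris _
  have hcont : Continuous fun p : unitInterval × (ℕ → ℝ) => (1 - (p.1 : ℝ)) • p.2 := by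
    fun_prop
  have hmem (t : unitInterval) (A : Set (ℕ → ℝ))
      (hA : A.Nonempty ∧ IsCompact A ∧ MaxPlusConvex A) :
      ((fun x : ℕ → ℝ => (1 - (t : ℝ)) • x) '' A).Nonempty ∧
        IsCompact ((fun x : ℕ → ℝ => (1 - (t : ℝ)) • x) '' A) ∧
        MaxPlusConvex ((fun x : ℕ → ℝ => (1 - (t : ℝ)) • x) '' A) :=
    ⟨hA.1.image _, hA.2.1.image (by fun_prop),
      hA.2.2.image_smul (sub_nonneg.mpr t.2.2)⟩
  let zero : MPCC := ⟨{0}, Set.singleton_nonempty 0, isCompact_singleton, by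
    rintro _ rfl _ rfl t ht
    ext i
    simp [ht]⟩
  refine (contractible_iff_id_nullhomotopic MPCC).mpr ⟨zero, ⟨?_⟩⟩
  exact
    { toFun := fun p => ⟨_, hmem p.1 p.2 p.2.2⟩
      continuous_toFun := continuous_vietoris_image (fun _ hA => hA.2.1) hcont hmem
      map_zero_left := fun A => by
        apply Subtype.ext
        simp
      map_one_left := fun A => by
        apply Subtype.ext
        simpa [zero] using A.2.1.image_const (0 : ℕ → ℝ) }
end

section
/- The map max : mpcc(ℝ^ω) → (ℕ → ℝ), sending a nonempty compact max-plus convex subset A of ℕ → ℝ to its pointwise supremum fun n => sup_{a ∈ A} a n, is continuous (with respect to the Hausdorff metric topology on mpcc(ℝ^ω) and the product topology on ℕ → ℝ), and it sends each singleton {x} to x; thus, composed with the singleton embedding, it is a retraction of mpcc(ℝ^ω) onto the subspace of singletons. -/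
/-- The pointwise supremum of a set of functions `ℕ → ℝ`. -/
noncomputable def mSup (A : Set (ℕ → ℝ)) : ℕ → ℝ :=
  fun n => sSup ((fun a => a n) '' A)

/-- The singletons are max-plus convex. -/
theorem maxPlusConvex_singleton {ι : Type*} (x : ι → ℝ) : MaxPlusConvex {x} := by
  rintro a rfl b rfl t ht
  exact funext fun i => max_eq_left (by linarith)

theorem mSup_singleton (x : ℕ → ℝ) : mSup {x} = x := by
  funext n
  simp [mSup]

section Vietoris

open scoped Topology

variable {X : Type*} [TopologicalSpace X] {P : Set X → Prop} {U : Set X}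

theorem isOpen_vietoris_subset (hU : IsOpen U) :
    IsOpen[vietoris P] {K : {A : Set X // P A} | (K : Set X) ⊆ U} :=
  TopologicalSpace.isOpen_generateFrom_of_mem ⟨U, hU, Or.inl rfl⟩

theorem isOpen_vietoris_inter_nonempty (hU : IsOpen U) :
    IsOpen[vietoris P] {K : {A : Set X // P A} | ((K : Set X) ∩ U).Nonempty} :=
  TopologicalSpace.isOpen_generateFrom_of_mem ⟨U, hU, Or.inr rfl⟩

/-- A map into singletons is continuous for the Vietoris topology as soon as the
underlying point map is continuous. -/
theorem continuous_vietoris_of_eq_singleton {Y : Type*} [TopologicalSpace Y] {f : Y → X}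
    (hf : Continuous f) {g : Y → {A : Set X // P A}} (hg : ∀ y, (g y : Set X) = {f y}) :
    @Continuous _ _ _ (vietoris P) g := by
  refine continuous_generateFrom_iff.2 ?_
  rintro _ ⟨U, hU, rfl | rfl⟩ <;>
    simpa [Set.preimage, hg] using hU.preimage hf

/-- The supremum of a continuous real function over nonempty compact sets depends
continuously on the set in the Vietoris topology. -/
theorem continuous_vietoris_sSup_image (hP : ∀ A, P A → A.Nonempty ∧ IsCompact A) {f : X → ℝ}
    (hf : Continuous f) :
    @Continuous _ _ (vietoris P) _ fun A : {A : Set X // P A} => sSup (f '' (A : Set X)) := by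
  let _ : TopologicalSpace {A : Set X // P A} := vietoris P
  refine OrderTopology.continuous_iff.2 fun c => ⟨?_, ?_⟩
  · convert isOpen_vietoris_inter_nonempty (P := P)
      (isOpen_Ioi.preimage hf : IsOpen (f ⁻¹' Set.Ioi c))
      using 1
    ext A
    obtain ⟨hne, hc⟩ := hP A A.2
    simp [lt_csSup_iff (hc.image hf).bddAbove (hne.image f), Set.Nonempty]
  · convert isOpen_vietoris_subset (P := P) (isOpen_Iio.preimage hf : IsOpen (f ⁻¹' Set.Iio c))
      using 1
    ext A
    obtain ⟨hne, hc⟩ := hP A A.2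
    simp [hc.sSup_lt_iff_of_continuous hne hf.continuousOn, Set.subset_def]

end Vietoris

/-- The map `max : mpcc(ℝ^ω) → ℝ^ω` sending `A` to its pointwise supremum is
continuous and sends each singleton `{x}` to `x`; composed with the singleton
embedding it yields a (continuous) retraction of `mpcc(ℝ^ω)` onto the subspace
of singletons. -/
theorem mpcc_max_continuous_retraction :
    letI : TopologicalSpace MPCC := vietoris _
    (Continuous fun A : MPCC => mSup (A : Set (ℕ → ℝ))) ∧
      (∀ x : ℕ → ℝ, mSup {x} = x) ∧
      ∃ r : MPCC → MPCC, Continuous r ∧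
        (∀ A : MPCC, (r A : Set (ℕ → ℝ)) = {mSup (A : Set (ℕ → ℝ))}) ∧
        (∀ A : MPCC, (∃ x : ℕ → ℝ, (A : Set (ℕ → ℝ)) = {x}) → r A = A) := by
  let _ : TopologicalSpace MPCC := vietoris _
  have hcont : Continuous fun A : MPCC => mSup (A : Set (ℕ → ℝ)) :=
    continuous_pi fun n =>
      continuous_vietoris_sSup_image (fun _ hA => ⟨hA.1, hA.2.1⟩) (continuous_apply n)
  refine ⟨hcont, mSup_singleton,
    fun A => ⟨{mSup A}, Set.singleton_nonempty _, isCompact_singleton, maxPlusConvex_singleton _⟩,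
    continuous_vietoris_of_eq_singleton hcont fun _ => rfl, fun _ => rfl, ?_⟩
  rintro A ⟨x, hx⟩
  exact Subtype.ext (by simp only [hx, mSup_singleton])
end
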